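/- Fix a prime p and a commutative ring R of characteristic p, and let B(R) be the p-typical algebra with generators x = (x_0, x_1, …), y = (y_0, y_1, …). Then for all i, j, k, l ∈ ℕ: if i ≥ k and j ≥ l, then [y_j^{p^k}, x_i^{p^l}] = c_{i−k, j−l}(x_k^{p^l},…,x_{i−1}^{p^l}, y_l^{p^k},…,y_{j−1}^{p^k}) (the polynomial c_{i−k,j−l} evaluated with X_r ↦ x_{k+r}^{p^l} and Y_s ↦ y_{l+s}^{p^k}); otherwise [y_j^{p^k}, x_i^{p^l}] = 0. In particular [y_j^{p^i}, x_i^{p^j}] = 1, and [y_j^{p^k}, x_i] = 0 for k > i, [y_j, x_i^{p^l}] = 0 for l > j. -/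

import Mathlib

noncomputable section

/-- The product `∏ i, x i ^ e i` over the support of `e`, with factors multiplied in
increasing order of the index. -/
def ordProd {σ M : Type*} [LinearOrder σ] [Monoid M] (x : σ → M) (e : σ →₀ ℕ) : M :=
  ((e.support.sort (· ≤ ·)).map fun i => x i ^ e i).prod

/-- Evaluation of a multivariate polynomial in a (possibly noncommutative) algebra:
each monomial is evaluated as the ordered product of the powers of the substituted
values, the variables being multiplied in increasing order of their (linearly ordered)
index. -/
def pEval {σ R A : Type*} [LinearOrder σ] [CommSemiring R] [Semiring A] [Algebra R A]
    (x : σ → A) (q : MvPolynomial σ R) : A :=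
  q.support.sum fun e => MvPolynomial.coeff e q • ordProd x e

/-- Evaluation of an integral polynomial in the commuting variables `X_d` (`d : ℕ+`, left
summand) and `Y_e` (`e : ℕ+`, right summand), substituting `x d` for `X_d` and `y e` for
`Y_e`; in each monomial all `X`-factors (in increasing index order) are multiplied to the
left of all `Y`-factors (in increasing index order), as appropriate for a polynomial in
`ℤ[X][Y]`. -/
def cEval {A : Type*} [Ring A] (x y : ℕ+ → A) (q : MvPolynomial (ℕ+ ⊕ₗ ℕ+) ℤ) : A :=
  pEval (fun v => Sum.elim x y (ofLex v)) q

/-- The `k`-th ghost value `w_k(g) = ∑_{d ∣ k} d · (g d)^(k/d)`. -/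
def ghost {A : Type*} [Ring A] (g : ℕ+ → A) (k : ℕ+) : A :=
  ∑ d ∈ (k : ℕ).divisors.attach,
    ((d : ℕ) : A) * g ⟨(d : ℕ), Nat.pos_of_mem_divisors d.2⟩ ^ ((k : ℕ) / (d : ℕ))

/-- The generator `x_d` of the free algebra underlying `B(ℚ)`. -/
def bXf (d : ℕ+) : FreeAlgebra ℚ (ℕ+ ⊕ ℕ+) := FreeAlgebra.ι ℚ (Sum.inl d)

/-- The generator `y_e` of the free algebra underlying `B(ℚ)`. -/
def bYf (e : ℕ+) : FreeAlgebra ℚ (ℕ+ ⊕ ℕ+) := FreeAlgebra.ι ℚ (Sum.inr e)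

/-- The defining relations of `B(ℚ)`: `[w_k(x), w_l(x)] = 0`, `[w_k(y), w_l(y)] = 0` and
`[w_l(y), w_k(x)] = δ_{k,l}·k` for all `k, l ≥ 1`. -/
inductive BRel : FreeAlgebra ℚ (ℕ+ ⊕ ℕ+) → FreeAlgebra ℚ (ℕ+ ⊕ ℕ+) → Prop
  | xx (k l : ℕ+) : BRel (ghost bXf k * ghost bXf l) (ghost bXf l * ghost bXf k)
  | yy (k l : ℕ+) : BRel (ghost bYf k * ghost bYf l) (ghost bYf l * ghost bYf k)
  | yx (k l : ℕ+) : BRel (ghost bYf l * ghost bXf k)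
      (ghost bXf k * ghost bYf l + if k = l then ((k : ℕ) : FreeAlgebra ℚ (ℕ+ ⊕ ℕ+)) else 0)

/-- The universal algebra `B(ℚ)`. -/
abbrev BQ : Type := RingQuot BRel

/-- The generator `x_d` of `B(ℚ)`. -/
def bx (d : ℕ+) : BQ := RingQuot.mkAlgHom ℚ BRel (bXf d)

/-- The generator `y_e` of `B(ℚ)`. -/
def by' (e : ℕ+) : BQ := RingQuot.mkAlgHom ℚ BRel (bYf e)

/-- `c` is a family of polynomials `c_{m,n}` as in the paper: `c m n` is an integral
polynomial in the variables `X_d` (`d` a proper divisor of `m`) and `Y_e` (`e` a proper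
divisor of `n`) such that `[y_n, x_m] = c_{m,n}(x, y)` holds in `B(ℚ)`. -/
def IsCFamily (c : ℕ+ → ℕ+ → MvPolynomial (ℕ+ ⊕ₗ ℕ+) ℤ) : Prop :=
  ∀ m n : ℕ+,
    (∀ v ∈ (c m n).vars,
      (∃ d : ℕ+, (d : ℕ) ∣ (m : ℕ) ∧ d ≠ m ∧ ofLex v = Sum.inl d) ∨
      (∃ e : ℕ+, (e : ℕ) ∣ (n : ℕ) ∧ e ≠ n ∧ ofLex v = Sum.inr e)) ∧
    cEval bx by' (c m n) = by' n * bx m - bx m * by' n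


/-- `p ^ i` as a positive natural number. -/
def ppow (p i : ℕ) : ℕ+ := (p ^ i).toPNat'

/-- Substitution of the generators `x_0, x_1, …` for the variables `X_{p^0}, X_{p^1}, …`
(the variable `X_{p^r}` is sent to `x_r`). -/
def sxI (R : Type*) [CommRing R] (p : ℕ) : ℕ+ → FreeAlgebra R (ℕ ⊕ ℕ) :=
  fun d => FreeAlgebra.ι R (Sum.inl (padicValNat p (d : ℕ)))

/-- Substitution of the generators `y_0, y_1, …` for the variables `Y_{p^0}, Y_{p^1}, …`
(the variable `Y_{p^s}` is sent to `y_s`). -/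
def syI (R : Type*) [CommRing R] (p : ℕ) : ℕ+ → FreeAlgebra R (ℕ ⊕ ℕ) :=
  fun e => FreeAlgebra.ι R (Sum.inr (padicValNat p (e : ℕ)))

/-- The defining relations of the `p`-typical algebra `B(R)`: `[x_i, x_{i'}] = 0`,
`[y_j, y_{j'}] = 0` and `[y_j, x_i] = c_{p^i, p^j}(x_0, …, x_{i-1}, y_0, …, y_{j-1})`. -/
inductive BIRel (R : Type*) [CommRing R] (p : ℕ)
    (c : ℕ+ → ℕ+ → MvPolynomial (ℕ+ ⊕ₗ ℕ+) ℤ) :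
    FreeAlgebra R (ℕ ⊕ ℕ) → FreeAlgebra R (ℕ ⊕ ℕ) → Prop
  | xx (i i' : ℕ) : BIRel R p c
      (FreeAlgebra.ι R (Sum.inl i) * FreeAlgebra.ι R (Sum.inl i'))
      (FreeAlgebra.ι R (Sum.inl i') * FreeAlgebra.ι R (Sum.inl i))
  | yy (j j' : ℕ) : BIRel R p c
      (FreeAlgebra.ι R (Sum.inr j) * FreeAlgebra.ι R (Sum.inr j'))
      (FreeAlgebra.ι R (Sum.inr j') * FreeAlgebra.ι R (Sum.inr j))
  | yx (i j : ℕ) : BIRel R p c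
      (FreeAlgebra.ι R (Sum.inr j) * FreeAlgebra.ι R (Sum.inl i))
      (FreeAlgebra.ι R (Sum.inl i) * FreeAlgebra.ι R (Sum.inr j) +
        cEval (sxI R p) (syI R p) (c (ppow p i) (ppow p j)))

/-- The `p`-typical algebra `B(R)`. -/
abbrev BI (R : Type*) [CommRing R] (p : ℕ) (c : ℕ+ → ℕ+ → MvPolynomial (ℕ+ ⊕ₗ ℕ+) ℤ) :
    Type _ := RingQuot (BIRel R p c)

/-- The generator `x_i` of the `p`-typical algebra `B(R)`. -/
def gxI (R : Type*) [CommRing R] (p : ℕ) (c : ℕ+ → ℕ+ → MvPolynomial (ℕ+ ⊕ₗ ℕ+) ℤ)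
    (i : ℕ) : BI R p c :=
  RingQuot.mkAlgHom R (BIRel R p c) (FreeAlgebra.ι R (Sum.inl i))

/-- The generator `y_j` of the `p`-typical algebra `B(R)`. -/
def gyI (R : Type*) [CommRing R] (p : ℕ) (c : ℕ+ → ℕ+ → MvPolynomial (ℕ+ ⊕ₗ ℕ+) ℤ)
    (j : ℕ) : BI R p c :=
  RingQuot.mkAlgHom R (BIRel R p c) (FreeAlgebra.ι R (Sum.inr j))

namespace PowerSeries

/-- The Euler operator `X · d/dX` on power series over a possibly noncommutative ring. -/
def euler {B : Type*} [Ring B] : PowerSeries B →+ PowerSeries B where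
  toFun f := PowerSeries.mk fun n => (n : B) * coeff n f
  map_zero' := by ext; simp
  map_add' f g := by ext; simp [mul_add]

/-- The substitution `X ↦ X ^ p` on power series over a possibly noncommutative ring. -/
def spreadFun {B : Type*} [Ring B] (p : ℕ) (f : PowerSeries B) : PowerSeries B :=
  PowerSeries.mk fun n => if p ∣ n then coeff (n / p) f else 0

/-- The lacunary power series `∑ i, w i * X ^ (p ^ i)`. -/
def powSeries {B : Type*} [Ring B] (p : ℕ) (w : ℕ → B) : PowerSeries B :=
  PowerSeries.mk fun n => ∑ i ∈ Finset.range (n + 1), if p ^ i = n then w i else 0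

section

variable {B : Type*} [Ring B]

theorem coeff_euler (f : PowerSeries B) (n : ℕ) : coeff n (euler f) = (n : B) * coeff n f := by
  simp [euler]

theorem euler_mul (f g : PowerSeries B) : euler (f * g) = euler f * g + f * euler g := by
  ext n
  simp only [coeff_euler, coeff_mul, map_add, Finset.mul_sum, ← Finset.sum_add_distrib]
  refine Finset.sum_congr rfl fun x hx => ?_
  rw [← Finset.HasAntidiagonal.mem_antidiagonal.1 hx, Nat.cast_add, add_mul, ← mul_assoc, ← mul_assoc,
    ← mul_assoc, (Nat.cast_commute x.2 (coeff x.1 f)).eq]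

theorem euler_C (b : B) : euler (C b) = 0 := by
  ext n
  rw [coeff_euler, coeff_C]
  split_ifs with h <;> simp [h]

theorem euler_one : euler (1 : PowerSeries B) = 0 := by
  rw [← map_one C, euler_C]

theorem euler_map {B' : Type*} [Ring B'] (h : B →+* B') (f : PowerSeries B) :
    euler (map h f) = map h (euler f) := by
  ext n; simp [coeff_euler]

theorem coeff_spreadFun_mul {p : ℕ} (hp : p ≠ 0) (f : PowerSeries B) (n : ℕ) :
    coeff (p * n) (spreadFun p f) = coeff n f := by
  simp [spreadFun, Nat.mul_div_cancel_left _ (Nat.pos_of_ne_zero hp)]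

theorem coeff_spreadFun_of_not_dvd {p n : ℕ} (h : ¬ p ∣ n) (f : PowerSeries B) :
    coeff n (spreadFun p f) = 0 := by
  simp [spreadFun, h]

theorem spreadFun_mul {p : ℕ} (hp : p ≠ 0) (f g : PowerSeries B) :
    spreadFun p (f * g) = spreadFun p f * spreadFun p g := by
  ext n
  by_cases h : p ∣ n
  · obtain ⟨m, rfl⟩ := h
    rw [coeff_spreadFun_mul hp, coeff_mul, coeff_mul]
    refine Finset.sum_of_injOn (fun x => (p * x.1, p * x.2)) ?_ ?_ ?_ ?_
    · rintro ⟨a, b⟩ - ⟨c, d⟩ - h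
      simpa [hp] using h
    · rintro ⟨a, b⟩ h
      simp only [Finset.mem_coe,
        Finset.HasAntidiagonal.mem_antidiagonal] at h ⊢
      rw [← h, mul_add]
    · rintro ⟨a, b⟩ h hn
      rw [Finset.HasAntidiagonal.mem_antidiagonal] at h
      dsimp only at h ⊢
      by_cases ha : p ∣ a
      · have hb : p ∣ b := (Nat.dvd_add_right ha).1 (h ▸ dvd_mul_right p m)
        obtain ⟨a, rfl⟩ := ha
        obtain ⟨b, rfl⟩ := hb
        refine absurd ⟨(a, b), ?_, rfl⟩ hn
        rw [← mul_add] at h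
        simpa using Nat.eq_of_mul_eq_mul_left (Nat.pos_of_ne_zero hp) h
      · rw [coeff_spreadFun_of_not_dvd ha, zero_mul]
    · rintro ⟨a, b⟩ -
      simp only [coeff_spreadFun_mul hp]
  · rw [coeff_spreadFun_of_not_dvd h, coeff_mul, Finset.sum_eq_zero]
    rintro ⟨a, b⟩ hab
    rw [Finset.HasAntidiagonal.mem_antidiagonal] at hab
    by_cases ha : p ∣ a
    · have hb : ¬ p ∣ b := fun hb => h (hab ▸ dvd_add ha hb)
      rw [coeff_spreadFun_of_not_dvd hb, mul_zero]
    · rw [coeff_spreadFun_of_not_dvd ha, zero_mul]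

theorem spreadFun_C (p : ℕ) (b : B) : spreadFun p (C b) = C b := by
  ext n
  simp only [spreadFun, coeff_mk, coeff_C]
  by_cases h : n = 0
  · simp [h]
  · by_cases hd : p ∣ n
    · obtain ⟨m, rfl⟩ := hd
      have : p * m / p ≠ 0 := by
        have hp : 0 < p := Nat.pos_of_ne_zero fun h0 => h (by simp [h0])
        rw [Nat.mul_div_cancel_left _ hp]
        exact fun h0 => h (by simp [h0])
      simp [this, h]
    · simp [hd, h]

/-- The ring endomorphism `X ↦ X ^ p` of power series over a possibly noncommutative ring. -/
def spread {p : ℕ} (hp : p ≠ 0) : PowerSeries B →+* PowerSeries B where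
  toFun := spreadFun p
  map_one' := by rw [← map_one C, spreadFun_C]
  map_mul' := spreadFun_mul hp
  map_zero' := by ext; simp [spreadFun]
  map_add' f g := by
    ext n
    simp only [spreadFun, coeff_mk, map_add]
    split_ifs <;> simp

variable {p : ℕ} (hp : p ≠ 0)

theorem spread_C (b : B) : spread hp (C b) = C b := spreadFun_C p b

theorem coeff_spread_mul (f : PowerSeries B) (n : ℕ) : coeff (p * n) (spread hp f) = coeff n f :=
  coeff_spreadFun_mul hp f n

theorem coeff_spread (f : PowerSeries B) (n : ℕ) :
    coeff n (spread hp f) = if p ∣ n then coeff (n / p) f else 0 := by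
  simp [spread, spreadFun]

theorem spread_injective : Function.Injective (spread (B := B) hp) := fun f g h => by
  ext n
  rw [← coeff_spread_mul hp, h, coeff_spread_mul]

theorem spread_map {B' : Type*} [Ring B'] (h : B →+* B') (f : PowerSeries B) :
    spread hp (map h f) = map h (spread hp f) := by
  ext n
  simp only [coeff_spread, coeff_map]
  split_ifs <;> simp

theorem euler_spread (f : PowerSeries B) :
    euler (spread hp f) = C (p : B) * spread hp (euler f) := by
  ext n
  rw [coeff_C_mul, coeff_euler, coeff_spread, coeff_spread]
  split_ifs with h
  · obtain ⟨m, rfl⟩ := h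
    rw [Nat.mul_div_cancel_left _ (Nat.pos_of_ne_zero hp), coeff_euler, Nat.cast_mul, mul_assoc]
  · simp

theorem constantCoeff_spread (f : PowerSeries B) :
    constantCoeff (spread hp f) = constantCoeff f := by
  rw [← coeff_zero_eq_constantCoeff_apply, coeff_spread]
  simp

theorem coeff_powSeries_pow (hp : 2 ≤ p) (w : ℕ → B) (i : ℕ) :
    coeff (p ^ i) (powSeries p w) = w i := by
  have : i < p ^ i + 1 := (Nat.lt_pow_self hp).trans (Nat.lt_succ_self _)
  rw [powSeries, coeff_mk, Finset.sum_eq_single i]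
  · simp
  · intro j _ hj
    rw [if_neg fun h => hj (Nat.pow_right_injective hp h)]
  · intro h
    exact absurd (Finset.mem_range.2 this) h

theorem coeff_powSeries_of_ne {n : ℕ} (h : ∀ i, p ^ i ≠ n) (w : ℕ → B) :
    coeff n (powSeries p w) = 0 := by
  simp [powSeries, h]

theorem powSeries_ext (hp : 2 ≤ p) {w : ℕ → B} {f : PowerSeries B}
    (h : ∀ i, coeff (p ^ i) f = w i) (h' : ∀ n, (∀ i, p ^ i ≠ n) → coeff n f = 0) :
    f = powSeries p w := by
  ext n
  by_cases hn : ∃ i, p ^ i = n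
  · obtain ⟨i, rfl⟩ := hn
    rw [h, coeff_powSeries_pow hp]
  · push Not at hn
    rw [h' n hn, coeff_powSeries_of_ne hn]

theorem constantCoeff_powSeries (hp : 2 ≤ p) (w : ℕ → B) :
    constantCoeff (powSeries p w) = 0 := by
  rw [← coeff_zero_eq_constantCoeff_apply, coeff_powSeries_of_ne]
  intro i
  positivity

theorem map_powSeries {B' : Type*} [Ring B'] (h : B →+* B') (w : ℕ → B) :
    map h (powSeries p w) = powSeries p fun i => h (w i) := by
  ext n
  simp only [powSeries, coeff_map, coeff_mk, map_sum]
  exact Finset.sum_congr rfl fun i _ => by split_ifs <;> simp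

theorem powSeries_add (w w' : ℕ → B) :
    powSeries p w + powSeries p w' = powSeries p fun i => w i + w' i := by
  ext n
  simp only [powSeries, map_add, coeff_mk, ← Finset.sum_add_distrib]
  exact Finset.sum_congr rfl fun i _ => by split_ifs <;> simp

theorem powSeries_mul_C (w : ℕ → B) (b : B) :
    powSeries p w * C b = powSeries p fun i => w i * b := by
  ext n
  simp only [powSeries, coeff_mul_C, coeff_mk, Finset.sum_mul]
  exact Finset.sum_congr rfl fun i _ => by split_ifs <;> simp

theorem C_mul_powSeries (w : ℕ → B) (b : B) :
    C b * powSeries p w = powSeries p fun i => b * w i := by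
  ext n
  simp only [powSeries, coeff_C_mul, coeff_mk, Finset.mul_sum]
  exact Finset.sum_congr rfl fun i _ => by split_ifs <;> simp

theorem spread_powSeries (h2 : 2 ≤ p) (w : ℕ → B) (hw : w 0 = 0) :
    spread hp (powSeries p fun i => w (i + 1)) = powSeries p w := by
  refine powSeries_ext h2 (fun i => ?_) fun n hn => ?_
  · cases i with
    | zero =>
      rw [pow_zero, coeff_spread, if_neg (by simp; omega), hw]
    | succ i => rw [pow_succ', coeff_spread_mul, coeff_powSeries_pow h2]
  · rw [coeff_spread]
    split_ifs with h
    · obtain ⟨m, rfl⟩ := h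
      rw [Nat.mul_div_cancel_left _ (Nat.pos_of_ne_zero hp), coeff_powSeries_of_ne]
      exact fun i hi => hn (i + 1) (by rw [pow_succ', hi])
    · rfl

/-- A power series over a torsion-free ring vanishes if it has constant coefficient zero and
satisfies a linear differential equation `X · f' = W * f` with `W` of constant coefficient
zero. -/
theorem eq_zero_of_euler_eq [IsAddTorsionFree B] {W f : PowerSeries B}
    (hW : constantCoeff W = 0) (h0 : constantCoeff f = 0) (h : euler f = W * f) : f = 0 := by
  ext n
  rw [map_zero]
  induction n using Nat.strong_induction_on with
  | _ n ih =>
    rcases Nat.eq_zero_or_pos n with rfl | hn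
    · simpa using h0
    have h1 : (n : B) * coeff n f = 0 := by
      rw [← coeff_euler, h, coeff_mul, Finset.sum_eq_zero]
      rintro ⟨a, b⟩ hab
      rw [Finset.HasAntidiagonal.mem_antidiagonal] at hab
      dsimp only at hab ⊢
      rcases Nat.eq_zero_or_pos a with rfl | ha
      · rw [coeff_zero_eq_constantCoeff_apply, hW, zero_mul]
      · rw [ih b (by omega), mul_zero]
    rw [← nsmul_eq_mul] at h1
    exact (nsmul_eq_zero_iff_right hn.ne').1 h1

theorem eq_of_euler_eq [IsAddTorsionFree B] {W f g : PowerSeries B}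
    (hW : constantCoeff W = 0) (h0 : constantCoeff f = constantCoeff g)
    (hf : euler f = W * f) (hg : euler g = W * g) : f = g := by
  refine sub_eq_zero.1 (eq_zero_of_euler_eq hW (by simp [h0]) ?_)
  rw [map_sub, hf, hg, mul_sub]

end

end PowerSeries

namespace ArtinHasse

open PowerSeries

/-- The coefficients of the solution of `X · f' = W * f` with constant coefficient `1`. -/
def eulerSolution {K : Type*} [Field K] (W : PowerSeries K) : ℕ → K
  | 0 => 1
  | n + 1 => ((n + 1 : ℕ) : K)⁻¹ *
      ∑ i : Fin (n + 1), coeff (n + 1 - (i : ℕ)) W * eulerSolution W i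

theorem exists_euler_eq {K : Type*} [Field K] [CharZero K] (W : PowerSeries K)
    (hW : constantCoeff W = 0) :
    ∃ f : PowerSeries K, constantCoeff f = 1 ∧ euler f = W * f := by
  refine ⟨PowerSeries.mk (eulerSolution W), ?_, ?_⟩
  · rw [← coeff_zero_eq_constantCoeff_apply, coeff_mk, eulerSolution]
  · ext n
    rw [coeff_euler, coeff_mk, mul_comm W, coeff_mul]
    cases n with
    | zero => simp [hW]
    | succ n =>
      rw [eulerSolution, mul_inv_cancel_left₀ (by exact_mod_cast Nat.succ_ne_zero n),
        Finset.Nat.sum_antidiagonal_eq_sum_range_succ_mk, Finset.sum_range_succ]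
      simp only [coeff_mk, Nat.sub_self, coeff_zero_eq_constantCoeff, hW, mul_zero, add_zero]
      rw [← Fin.sum_univ_eq_sum_range
        (fun i => eulerSolution W i * coeff (n + 1 - i) W) (n + 1)]
      exact Finset.sum_congr rfl fun i _ => mul_comm _ _

theorem euler_pow {K : Type*} [CommRing K] {W f : PowerSeries K} (h : euler f = W * f) (n : ℕ) :
    euler (f ^ n) = C (n : K) * W * f ^ n := by
  induction n with
  | zero => simp [euler_one]
  | succ n ih =>
    rw [pow_succ, euler_mul, ih, h, Nat.cast_succ, map_add, map_one]
    ring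

/-- The power series `exp (p * X)`. -/
def expMul (p : ℕ) (K : Type*) [Field K] : PowerSeries K := PowerSeries.mk fun n => (p : K) ^ n / n.factorial

theorem euler_expMul (p : ℕ) (K : Type*) [Field K] [CharZero K] :
    euler (expMul p K) = C (p : K) * X * expMul p K := by
  ext n
  rw [coeff_euler, mul_assoc, coeff_C_mul]
  cases n with
  | zero => simp
  | succ n =>
    rw [coeff_succ_X_mul, expMul, coeff_mk, coeff_mk, Nat.factorial_succ]
    have : ((n + 1 : ℕ) : K) ≠ 0 := by exact_mod_cast Nat.succ_ne_zero n
    have h2 : ((n.factorial : ℕ) : K) ≠ 0 := by exact_mod_cast Nat.factorial_ne_zero n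
    rw [Nat.cast_mul]
    field_simp
    ring

variable (p : ℕ) [hp : Fact p.Prime]

theorem spread_powSeries_one (K : Type*) [CommRing K] :
    spread hp.out.ne_zero (powSeries p fun _ => (1 : K)) + X = powSeries p fun _ => (1 : K) := by
  refine powSeries_ext hp.out.two_le (fun i => ?_) fun n hn => ?_
  · cases i with
    | zero =>
      rw [pow_zero, map_add, coeff_spread, if_neg hp.out.not_dvd_one, coeff_one_X, zero_add]
    | succ i =>
      rw [map_add, pow_succ', coeff_spread_mul, coeff_powSeries_pow hp.out.two_le, coeff_X,
        if_neg, add_zero]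
      exact fun h => hp.out.not_dvd_one (h ▸ dvd_mul_right p (p ^ i))
  · rw [map_add, coeff_X, if_neg (fun h => hn 0 (by rw [h, pow_zero])), add_zero, coeff_spread]
    split_ifs with h
    · obtain ⟨m, rfl⟩ := h
      rw [Nat.mul_div_cancel_left _ hp.out.pos, coeff_powSeries_of_ne]
      exact fun i hi => hn (i + 1) (by rw [pow_succ', hi])
    · rfl

theorem pow_eq_spread_mul_expMul {K : Type*} [Field K] [CharZero K] {f : PowerSeries K}
    (h0 : constantCoeff f = 1) (h : euler f = (powSeries p fun _ => (1 : K)) * f) :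
    f ^ p = spread hp.out.ne_zero f * expMul p K := by
  set U : PowerSeries K := powSeries p fun _ => (1 : K)
  have hU : constantCoeff U = 0 := constantCoeff_powSeries hp.out.two_le _
  refine eq_of_euler_eq (W := C (p : K) * U) (by simp [hU]) ?_ (euler_pow h p) ?_
  · rw [map_pow, h0, map_mul, constantCoeff_spread, h0, ← coeff_zero_eq_constantCoeff_apply, expMul,
      coeff_mk]
    simp
  · rw [euler_mul, euler_spread, h, map_mul, euler_expMul]
    have hs : spread hp.out.ne_zero U + X = U := spread_powSeries_one p K
    linear_combination (C (p : K) * spread hp.out.ne_zero f * expMul p K) * hs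

theorem exists_pow_div_factorial {n : ℕ} (hn : n ≠ 0) :
    ∃ z : ℤ_[p], (p : ℚ_[p]) ^ n / n.factorial = (p : ℚ_[p]) * z := by
  have hp0 : (p : ℚ_[p]) ≠ 0 := by exact_mod_cast hp.out.ne_zero
  have hf : ((n.factorial : ℕ) : ℚ_[p]) ≠ 0 := by exact_mod_cast Nat.factorial_ne_zero n
  obtain ⟨v, u, hu, hv, hlt⟩ :
      ∃ v u : ℕ, n.factorial = p ^ v * u ∧ u.Coprime p ∧ v < n :=
    ⟨padicValNat p n.factorial, ordCompl[p] n.factorial, by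
      rw [← Nat.factorization_def _ hp.out, Nat.ordProj_mul_ordCompl_eq_self],
      (Nat.coprime_ordCompl hp.out (Nat.factorial_ne_zero n)).symm,
      padicValNat_factorial_lt_of_ne_zero p hn⟩
  obtain ⟨m, rfl⟩ := Nat.exists_eq_add_of_lt hlt
  have hunit : IsUnit (u : ℤ_[p]) := by
    rw [PadicInt.isUnit_iff, PadicInt.norm_natCast_eq_one_iff]
    exact hv.symm
  obtain ⟨w, hw⟩ := hunit.exists_right_inv
  have hw' : (u : ℚ_[p]) * w = 1 := by exact_mod_cast congrArg (fun z : ℤ_[p] => (z : ℚ_[p])) hw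
  refine ⟨(p : ℤ_[p]) ^ m * w, ?_⟩
  rw [div_eq_iff hf, hu]
  push_cast
  calc (p : ℚ_[p]) ^ (v + m + 1) = p * p ^ m * p ^ v * 1 := by ring
    _ = _ := by rw [← hw']; ring

theorem coeff_pow_prime (a : Polynomial ℤ_[p]) (n : ℕ) :
    ∃ z : ℤ_[p], (a ^ p).coeff n = (if p ∣ n then a.coeff (n / p) else 0) + p * z := by
  have h : PadicInt.toZMod ((a ^ p).coeff n - if p ∣ n then a.coeff (n / p) else 0) = 0 := by
    rw [map_sub, ← Polynomial.coeff_map, Polynomial.map_pow, ← ZMod.expand_card,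
      Polynomial.coeff_expand hp.out.pos]
    split_ifs <;> simp
  have h' := (RingHom.mem_ker (f := PadicInt.toZMod)).2 h
  rw [PadicInt.ker_toZMod, PadicInt.maximalIdeal_eq_span_p, Ideal.mem_span_singleton] at h'
  obtain ⟨z, hz⟩ := h'
  exact ⟨z, by rw [← hz]; ring⟩

theorem exists_coeff_eq_coe {f : PowerSeries ℚ_[p]} (h0 : constantCoeff f = 1)
    (h : euler f = (powSeries p fun _ => (1 : ℚ_[p])) * f) (n : ℕ) :
    ∃ z : ℤ_[p], coeff n f = z := by
  induction n using Nat.strong_induction_on with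
  | _ n ih =>
  rcases Nat.eq_zero_or_pos n with rfl | hn
  · exact ⟨1, by simp [h0]⟩
  choose g hg using ih
  set a : Polynomial ℤ_[p] := ∑ m : Fin n, Polynomial.monomial (m : ℕ) (g m m.2) with ha
  have hac : ∀ m (hm : m < n), a.coeff m = g m hm := by
    intro m hm
    rw [ha, Polynomial.finsetSum_coeff, Finset.sum_eq_single ⟨m, hm⟩]
    · simp
    · intro b _ hb
      rw [Polynomial.coeff_monomial, if_neg fun h => hb (Fin.ext h)]
    · simp
  have hac' : ∀ m, n ≤ m → a.coeff m = 0 := by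
    intro m hm
    rw [ha, Polynomial.finsetSum_coeff, Finset.sum_eq_zero]
    intro b _
    rw [Polynomial.coeff_monomial, if_neg]
    omega
  set A : PowerSeries ℚ_[p] := map PadicInt.Coe.ringHom (a : PowerSeries ℤ_[p]) with hA
  have hAc : ∀ m, coeff m A = (a.coeff m : ℚ_[p]) := fun m => by
    rw [hA, coeff_map, Polynomial.coeff_coe]; rfl
  obtain ⟨r, hr⟩ : X ^ n ∣ f - A := by
    rw [PowerSeries.X_pow_dvd_iff]
    intro m hm
    rw [map_sub, hAc, hac m hm, hg m hm, sub_self]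
  have hrn : constantCoeff r = coeff n f := by
    have := congrArg (coeff n) hr
    rw [map_sub, hAc, hac' n le_rfl, show coeff n (X ^ n * r) = constantCoeff r from by
      simpa using coeff_X_pow_mul r n 0] at this
    simpa using this.symm
  have hA0 : constantCoeff A = 1 := by
    rw [← coeff_zero_eq_constantCoeff_apply, hAc, hac 0 hn, ← hg 0 hn]
    simpa using h0
  obtain ⟨z, hz⟩ := Polynomial.powAddExpansion A (X ^ n * r) p
  have h1 : coeff n (f ^ p) = ((a ^ p).coeff n : ℚ_[p]) + p * coeff n f := by
    have : f = A + X ^ n * r := by rw [← hr]; ring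
    conv_lhs => rw [this, hz]
    rw [map_add, map_add]
    have e1 : coeff n (A ^ p) = ((a ^ p).coeff n : ℚ_[p]) := by
      rw [hA, ← map_pow, coeff_map, ← Polynomial.coe_pow, Polynomial.coeff_coe]; rfl
    have e2 : coeff n ((p : PowerSeries ℚ_[p]) * A ^ (p - 1) * (X ^ n * r)) = p * coeff n f := by
      rw [show (p : PowerSeries ℚ_[p]) * A ^ (p - 1) * (X ^ n * r) =
        X ^ n * ((p : PowerSeries ℚ_[p]) * A ^ (p - 1) * r) by ring]
      have := coeff_X_pow_mul ((p : PowerSeries ℚ_[p]) * A ^ (p - 1) * r) n 0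
      rw [zero_add] at this
      rw [this, coeff_zero_eq_constantCoeff_apply, map_mul, map_mul, map_pow, hA0, hrn]
      simp
    have e3 : coeff n (z * (X ^ n * r) ^ 2) = 0 := by
      have : X ^ (n + 1) ∣ z * (X ^ n * r) ^ 2 :=
        ⟨z * X ^ (n - 1) * r ^ 2, by
          obtain ⟨k, rfl⟩ := Nat.exists_eq_add_of_lt hn
          simp only [zero_add, Nat.add_sub_cancel]
          ring⟩
      exact PowerSeries.X_pow_dvd_iff.1 this n (Nat.lt_succ_self n)
    rw [e1, e2, e3, add_zero]
  obtain ⟨z1, hz1⟩ := coeff_pow_prime p a n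
  have hG : ∀ b, b ≠ 0 → ∃ w : ℤ_[p], coeff b (expMul p ℚ_[p]) = p * w := fun b hb => by
    rw [expMul, coeff_mk]; exact exists_pow_div_factorial p hb
  have hS : ∀ m, m < n → ∃ w : ℤ_[p], coeff m (spread hp.out.ne_zero f) = w := fun m hm => by
    rw [coeff_spread]
    split_ifs
    · exact ⟨_, hg (m / p) ((Nat.div_le_self _ _).trans_lt hm)⟩
    · exact ⟨0, by simp⟩
  obtain ⟨z2, hz2⟩ : ∃ w : ℤ_[p], coeff n (spread hp.out.ne_zero f * expMul p ℚ_[p]) =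
      coeff n (spread hp.out.ne_zero f) + p * w := by
    rw [coeff_mul, Finset.Nat.sum_antidiagonal_eq_sum_range_succ_mk, Finset.sum_range_succ]
    have hx : ∀ i ∈ Finset.range n, ∃ w : ℤ_[p], coeff i (spread hp.out.ne_zero f) *
        coeff (n - i) (expMul p ℚ_[p]) = p * w := by
      intro i hi
      have hi := Finset.mem_range.1 hi
      obtain ⟨w, hw⟩ := hS i hi
      obtain ⟨w', hw'⟩ := hG (n - i) (by omega)
      exact ⟨w * w', by rw [hw, hw']; push_cast; ring⟩
    choose! w hw using hx
    refine ⟨∑ i ∈ Finset.range n, w i, ?_⟩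
    rw [Finset.sum_congr rfl hw, ← Finset.mul_sum, PadicInt.coe_sum]
    have : coeff 0 (expMul p ℚ_[p]) = 1 := by simp [expMul]
    rw [Nat.sub_self, this]
    ring
  have hp0 : (p : ℚ_[p]) ≠ 0 := by exact_mod_cast hp.out.ne_zero
  have key : ((if p ∣ n then a.coeff (n / p) else 0 : ℤ_[p]) : ℚ_[p]) =
      coeff n (spread hp.out.ne_zero f) := by
    rw [coeff_spread]
    split_ifs
    · have := Nat.div_lt_self hn hp.out.one_lt
      rw [hac _ this, ← hg _ this]
    · simp
  refine ⟨z2 - z1, mul_left_cancel₀ hp0 ?_⟩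
  rw [pow_eq_spread_mul_expMul p h0 h, hz2, hz1] at h1
  push_cast at h1 ⊢
  rw [key] at h1
  linear_combination -h1

/-- The Artin–Hasse exponential exists over the `p`-adic integers. -/
theorem exists_artinHasse : ∃ E : PowerSeries ℤ_[p], constantCoeff E = 1 ∧
    euler E = (powSeries p fun _ => (1 : ℤ_[p])) * E := by
  obtain ⟨f, h0, h⟩ := exists_euler_eq (powSeries p fun _ => (1 : ℚ_[p]))
    (constantCoeff_powSeries hp.out.two_le _)
  choose g hg using exists_coeff_eq_coe p h0 h
  have hinj : Function.Injective (map (PadicInt.Coe.ringHom (p := p))) :=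
    PowerSeries.map_injective _ Subtype.coe_injective
  have hf : map PadicInt.Coe.ringHom (PowerSeries.mk g) = f := by
    ext n
    rw [coeff_map, coeff_mk, hg]; rfl
  refine ⟨PowerSeries.mk g, ?_, hinj ?_⟩
  · apply Subtype.coe_injective (p := fun x : ℚ_[p] => ‖x‖ ≤ 1)
    change ((constantCoeff (PowerSeries.mk g) : ℤ_[p]) : ℚ_[p]) = ((1 : ℤ_[p]) : ℚ_[p])
    rw [← coeff_zero_eq_constantCoeff_apply, coeff_mk, ← hg]
    simpa using h0
  · rw [← euler_map, map_mul, hf, map_powSeries, h]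
    simp

end ArtinHasse

namespace ArtinHasse

open PowerSeries

theorem succ_div_lt {p : ℕ} (hp : p.Prime) {n : ℕ} (i : Fin (n + 2)) : (i : ℕ) / p < n + 1 :=
  (Nat.div_le_div_right (Nat.le_of_lt_succ i.2)).trans_lt
    (Nat.div_lt_self n.succ_pos hp.one_lt)

/-- The coefficients of the multiplicative Artin–Hasse series
`∏ i, E (Y_i * s ^ (p ^ i))`. -/
def theta {k : Type*} [CommRing k] (p : ℕ) [hp : Fact p.Prime] (E : PowerSeries k) : ℕ → MvPolynomial ℕ k
  | 0 => 1
  | n + 1 => ∑ i : Fin (n + 2),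
      if p ∣ (i : ℕ) then
        MvPolynomial.C (coeff (n + 1 - (i : ℕ)) E) * MvPolynomial.X 0 ^ (n + 1 - (i : ℕ)) *
          MvPolynomial.rename Nat.succ (theta p E ((i : ℕ) / p))
      else 0
decreasing_by exact succ_div_lt hp.out i

section

variable {k : Type*} [CommRing k] (p : ℕ) [hp : Fact p.Prime] (E : PowerSeries k)

/-- The generating series of `theta`. -/
def thetaSeries : PowerSeries (MvPolynomial ℕ k) := PowerSeries.mk (theta p E)

/-- The first factor `E (Y_0 * s)`. -/
def thetaHead : PowerSeries (MvPolynomial ℕ k) :=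
  rescale (MvPolynomial.X 0) (map MvPolynomial.C E)

theorem coeff_thetaHead (n : ℕ) : coeff n (thetaHead E) =
    MvPolynomial.C (coeff n E) * MvPolynomial.X 0 ^ n := by
  rw [thetaHead, coeff_rescale, coeff_map, mul_comm]

/-- The shift of variables `Y_i ↦ Y_{i+1}`. -/
abbrev shift : MvPolynomial ℕ k →+* MvPolynomial ℕ k :=
  (MvPolynomial.rename Nat.succ : MvPolynomial ℕ k →ₐ[k] MvPolynomial ℕ k).toRingHom

theorem coeff_thetaHead_mul (f : PowerSeries (MvPolynomial ℕ k)) (n : ℕ) :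
    coeff n (thetaHead E * spread hp.out.ne_zero (map shift f)) =
      ∑ i ∈ Finset.range (n + 1), if p ∣ i then
        MvPolynomial.C (coeff (n - i) E) * MvPolynomial.X 0 ^ (n - i) * shift (coeff (i / p) f)
      else 0 := by
  rw [mul_comm, coeff_mul, Finset.Nat.sum_antidiagonal_eq_sum_range_succ_mk]
  refine Finset.sum_congr rfl fun i _ => ?_
  rw [coeff_spread, coeff_thetaHead, coeff_map]
  split_ifs
  · rw [mul_comm]
  · rw [zero_mul]

variable (hE : constantCoeff E = 1)
include hE

theorem theta_eq (n : ℕ) : theta p E n =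
    ∑ i ∈ Finset.range (n + 1), if p ∣ i then
        MvPolynomial.C (coeff (n - i) E) * MvPolynomial.X 0 ^ (n - i) *
          MvPolynomial.rename Nat.succ (theta p E (i / p))
      else 0 := by
  cases n with
  | zero => simp [theta, hE]
  | succ n =>
    rw [theta, ← Fin.sum_univ_eq_sum_range (fun i => if p ∣ i then
        MvPolynomial.C (coeff (n + 1 - i) E) * MvPolynomial.X 0 ^ (n + 1 - i) *
          MvPolynomial.rename Nat.succ (theta p E (i / p)) else 0)]

theorem thetaSeries_eq : thetaSeries p E =
    thetaHead E * spread hp.out.ne_zero (map shift (thetaSeries p E)) := by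
  ext1 n
  rw [coeff_thetaHead_mul, thetaSeries, coeff_mk, theta_eq p E hE]
  simp only [coeff_mk]
  rfl

theorem theta_mem_supported (n : ℕ) :
    theta p E n ∈ MvPolynomial.supported k {i | p ^ i ≤ n} := by
  induction n using Nat.strong_induction_on with
  | _ n ih =>
  rw [theta_eq p E hE]
  refine Subalgebra.sum_mem _ fun i hi => ?_
  have hi := Finset.mem_range.1 hi
  split_ifs with hd
  · obtain ⟨b, rfl⟩ := hd
    refine Subalgebra.mul_mem _ (Subalgebra.mul_mem _ (Subalgebra.algebraMap_mem _ _) ?_) ?_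
    · rcases Nat.eq_zero_or_pos (n - p * b) with h | h
      · rw [h, pow_zero]; exact Subalgebra.one_mem _
      · refine Subalgebra.pow_mem _ (Algebra.subset_adjoin (Set.mem_image_of_mem _ ?_)) _
        change p ^ 0 ≤ n
        rw [pow_zero]; omega
    · rw [Nat.mul_div_cancel_left _ hp.out.pos]
      rcases Nat.eq_zero_or_pos b with rfl | hb
      · simp only [theta, map_one]; exact Subalgebra.one_mem _
      have hbn : b < n := by nlinarith [hp.out.two_le]
      have h1 := ih b hbn
      rw [MvPolynomial.mem_supported] at h1 ⊢
      intro v hv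
      obtain ⟨r, hr, rfl⟩ := Finset.mem_image.1 (MvPolynomial.vars_rename _ _ hv)
      have hr' : p ^ r ≤ b := h1 hr
      change p ^ (r + 1) ≤ n
      rw [pow_succ']
      exact (Nat.mul_le_mul_left p hr').trans (by omega)
  · exact Subalgebra.zero_mem _

variable (hE' : euler E = (powSeries p fun _ => (1 : k)) * E)
include hE'

theorem coeff_one_eq : coeff 1 E = 1 := by
  have := congrArg (coeff 1) hE'
  rw [coeff_euler, coeff_mul, Finset.Nat.sum_antidiagonal_eq_sum_range_succ_mk] at this
  have h0 := constantCoeff_powSeries hp.out.two_le (fun _ => (1 : k))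
  have h1 := coeff_powSeries_pow hp.out.two_le (fun _ => (1 : k)) 0
  rw [pow_zero] at h1
  simpa [Finset.sum_range_succ, h0, h1, hE] using this

theorem theta_one : theta p E 1 = MvPolynomial.X 0 := by
  rw [theta_eq p E hE]
  simp [Finset.sum_range_succ, hp.out.ne_one, coeff_one_eq p E hE hE', theta]

theorem theta_pow_sub_mem (j : ℕ) :
    theta p E (p ^ j) - MvPolynomial.X j ∈ MvPolynomial.supported k (Set.Iio j) := by
  induction j with
  | zero =>
    rw [pow_zero, theta_one p E hE hE', sub_self]
    exact Subalgebra.zero_mem _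
  | succ j ih =>
    have hX : (MvPolynomial.X 0 : MvPolynomial ℕ k) ∈ MvPolynomial.supported k (Set.Iio (j + 1)) :=
      Algebra.subset_adjoin (Set.mem_image_of_mem _ (Set.mem_Iio.2 j.succ_pos))
    rw [theta_eq p E hE, Finset.sum_range_succ, if_pos (dvd_pow_self p j.succ_ne_zero), add_sub_assoc]
    refine Subalgebra.add_mem _ (Subalgebra.sum_mem _ fun i hi => ?_) ?_
    · have hi := Finset.mem_range.1 hi
      split_ifs with hd
      · obtain ⟨b, rfl⟩ := hd
        refine Subalgebra.mul_mem _ (Subalgebra.mul_mem _ (Subalgebra.algebraMap_mem _ _)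
          (Subalgebra.pow_mem _ hX _)) ?_
        rw [Nat.mul_div_cancel_left _ hp.out.pos]
        have h1 := theta_mem_supported p E hE b
        rw [MvPolynomial.mem_supported] at h1 ⊢
        intro v hv
        obtain ⟨r, hr, rfl⟩ := Finset.mem_image.1 (MvPolynomial.vars_rename _ _ hv)
        have hr' : p ^ r ≤ b := h1 hr
        rw [pow_succ'] at hi
        have hb := Nat.lt_of_mul_lt_mul_left hi
        exact Nat.succ_lt_succ ((Nat.pow_lt_pow_iff_right hp.out.one_lt).1 (hr'.trans_lt hb))
      · exact Subalgebra.zero_mem _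
    · rw [Nat.sub_self, pow_zero, mul_one, coeff_zero_eq_constantCoeff_apply, hE, map_one, one_mul,
        pow_succ, Nat.mul_div_cancel _ hp.out.pos,
        show (MvPolynomial.X (j + 1) : MvPolynomial ℕ k) =
          MvPolynomial.rename Nat.succ (MvPolynomial.X j) by simp, ← map_sub]
      rw [MvPolynomial.mem_supported] at ih ⊢
      intro v hv
      obtain ⟨r, hr, rfl⟩ := Finset.mem_image.1 (MvPolynomial.vars_rename _ _ hv)
      exact Nat.succ_lt_succ (ih hr)

theorem adjoin_range_theta : Algebra.adjoin k (Set.range (theta p E)) = ⊤ := by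
  have h : ∀ j, (MvPolynomial.X j : MvPolynomial ℕ k) ∈ Algebra.adjoin k (Set.range (theta p E)) := by
    intro j
    induction j using Nat.strong_induction_on with
    | _ j ih =>
    have h1 := theta_pow_sub_mem p E hE hE' j
    have h2 : MvPolynomial.supported k (Set.Iio j) ≤ Algebra.adjoin k (Set.range (theta p E)) := by
      refine Algebra.adjoin_le ?_
      rintro _ ⟨i, hi, rfl⟩
      exact ih i hi
    have h3 := Subalgebra.sub_mem _ (Algebra.subset_adjoin ⟨p ^ j, rfl⟩ :
      theta p E (p ^ j) ∈ Algebra.adjoin k (Set.range (theta p E))) (h2 h1)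
    rwa [sub_sub_cancel] at h3
  rw [eq_top_iff, ← MvPolynomial.adjoin_range_X]
  refine Algebra.adjoin_le ?_
  rintro _ ⟨j, rfl⟩
  exact h j

omit hE

theorem euler_thetaHead : euler (thetaHead E) =
    (powSeries p fun i => (MvPolynomial.X 0 : MvPolynomial ℕ k) ^ p ^ i) * thetaHead E := by
  have h1 : ∀ (a : MvPolynomial ℕ k) f, euler (rescale a f) = rescale a (euler f) := by
    intro a f
    ext1 n
    simp only [coeff_euler, coeff_rescale]
    ring
  have h2 : rescale (MvPolynomial.X 0) (powSeries p fun _ => (1 : MvPolynomial ℕ k)) =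
      powSeries p fun i => (MvPolynomial.X 0 : MvPolynomial ℕ k) ^ p ^ i := by
    refine powSeries_ext hp.out.two_le (fun i => ?_) fun n hn => ?_
    · rw [coeff_rescale, coeff_powSeries_pow hp.out.two_le, mul_one]
    · rw [coeff_rescale, coeff_powSeries_of_ne hn, mul_zero]
  rw [thetaHead, h1, euler_map, hE', map_mul, map_mul, map_powSeries, ← h2, map_one]

omit hE' hp in
theorem wittPolynomial_succ' (i : ℕ) : wittPolynomial p k (i + 1) =
    MvPolynomial.X 0 ^ p ^ (i + 1) + (p : MvPolynomial ℕ k) * shift (wittPolynomial p k i) := by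
  rw [wittPolynomial_eq_sum_C_mul_X_pow, wittPolynomial_eq_sum_C_mul_X_pow,
    Finset.sum_range_succ', add_comm, map_sum, Finset.mul_sum]
  congr 1
  · simp
  · refine Finset.sum_congr rfl fun r _ => ?_
    rw [Nat.add_sub_add_right, shift, map_mul, map_pow]
    simp [pow_succ', mul_assoc]

omit hE' in
theorem eq_zero_of_eq_mul_spread {B : Type*} [Ring B] (h : B →+* B) {D g : PowerSeries B}
    (h0 : constantCoeff D = 0) (hD : D = g * spread hp.out.ne_zero (map h D)) : D = 0 := by
  ext n
  rw [map_zero]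
  induction n using Nat.strong_induction_on with
  | _ n ih =>
  rcases Nat.eq_zero_or_pos n with rfl | hn
  · simpa using h0
  rw [hD, coeff_mul, Finset.sum_eq_zero]
  rintro ⟨a, b⟩ hab
  rw [Finset.HasAntidiagonal.mem_antidiagonal] at hab
  dsimp only at hab ⊢
  rw [coeff_spread, coeff_map]
  split_ifs
  · rw [ih, map_zero, mul_zero]
    exact (Nat.div_le_div_right (by omega)).trans_lt (Nat.div_lt_self hn hp.out.one_lt)
  · rw [mul_zero]

include hE

theorem euler_thetaSeries : euler (thetaSeries p E) =
    (powSeries p fun i => wittPolynomial p k i) * thetaSeries p E := by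
  set W : PowerSeries (MvPolynomial ℕ k) := powSeries p fun i => wittPolynomial p k i with hW
  set T := thetaSeries p E with hT
  have hT4 : T = thetaHead E * spread hp.out.ne_zero (map shift T) := thetaSeries_eq p E hE
  have hWs : W = (powSeries p fun i => (MvPolynomial.X 0 : MvPolynomial ℕ k) ^ p ^ i) +
      C (p : MvPolynomial ℕ k) * spread hp.out.ne_zero (map shift W) := by
    have h1 : spread hp.out.ne_zero (map shift W) = powSeries p fun i =>
        (match i with
        | 0 => 0
        | i + 1 => shift (wittPolynomial p k i) : MvPolynomial ℕ k) := by
      rw [hW, map_powSeries]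
      exact spread_powSeries hp.out.ne_zero hp.out.two_le (fun i =>
        (match i with
        | 0 => 0
        | i + 1 => shift (wittPolynomial p k i) : MvPolynomial ℕ k)) rfl
    rw [h1, C_mul_powSeries, powSeries_add, hW]
    congr 1
    funext i
    cases i with
    | zero => simp [wittPolynomial_zero]
    | succ i => exact wittPolynomial_succ' p i
  have h2 : euler T = (powSeries p fun i => (MvPolynomial.X 0 : MvPolynomial ℕ k) ^ p ^ i) * T +
      thetaHead E * (C (p : MvPolynomial ℕ k) * spread hp.out.ne_zero (map shift (euler T))) := by
    conv_lhs => rw [hT4]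
    rw [euler_mul, euler_thetaHead p E hE', euler_spread, euler_map, mul_assoc, ← hT4]
  refine sub_eq_zero.1 (eq_zero_of_eq_mul_spread p shift
    (g := thetaHead E * C (p : MvPolynomial ℕ k)) ?_ ?_)
  · rw [map_sub, map_mul, hW, constantCoeff_powSeries hp.out.two_le, zero_mul, sub_zero,
      ← coeff_zero_eq_constantCoeff_apply, coeff_euler]
    simp
  · rw [map_sub, map_sub, map_mul, map_mul]
    linear_combination h2 - T * hWs -
      C (p : MvPolynomial ℕ k) * spread hp.out.ne_zero (map shift W) * hT4

end

end ArtinHasse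

namespace PowerSeries

theorem commute_of_coeff {B : Type*} [Ring B] {f g : PowerSeries B}
    (h : ∀ i j, Commute (coeff i f) (coeff j g)) : Commute f g := by
  ext1 n
  rw [coeff_mul, coeff_mul, ← Finset.Nat.sum_antidiagonal_swap]
  exact Finset.sum_congr rfl fun x _ => h _ _

theorem isAddTorsionFree (B : Type*) [Ring B] [IsAddTorsionFree B] :
    IsAddTorsionFree (PowerSeries B) :=
  inferInstanceAs (IsAddTorsionFree ((Unit →₀ ℕ) → B))

/-- The diagonal embedding `∑ e_n X ^ n ↦ ∑ e_n t ^ n s ^ n` into iterated power series. -/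
def diag {B : Type*} [Ring B] : PowerSeries B →+* PowerSeries (PowerSeries B) where
  toFun e := PowerSeries.mk fun n => monomial n (coeff n e)
  map_one' := by
    ext1 n
    rw [coeff_mk, coeff_one, coeff_one]
    split_ifs with h
    · rw [h, monomial_zero_eq_C_apply, map_one]
    · rw [map_zero]
  map_mul' e f := by
    ext1 n
    rw [coeff_mk, coeff_mul, coeff_mul, map_sum]
    refine Finset.sum_congr rfl fun x hx => ?_
    rw [coeff_mk, coeff_mk, monomial_mul_monomial, Finset.HasAntidiagonal.mem_antidiagonal.1 hx]
  map_zero' := by ext1 n; simp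
  map_add' e f := by ext1 n; simp

section
variable {B : Type*} [Ring B]

theorem coeff_diag (e : PowerSeries B) (n : ℕ) : coeff n (diag e) = monomial n (coeff n e) := by
  simp [diag]

theorem euler_diag (e : PowerSeries B) : euler (diag e) = diag (euler e) := by
  ext1 n
  rw [coeff_euler, coeff_diag, coeff_diag, coeff_euler, ← nsmul_eq_mul, ← nsmul_eq_mul, map_nsmul]

theorem diag_powSeries_one {p : ℕ} (hp : 2 ≤ p) :
    diag (powSeries p fun _ => (1 : B)) = powSeries p fun i => (X : PowerSeries B) ^ p ^ i := by
  refine powSeries_ext hp (fun i => ?_) fun n hn => ?_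
  · rw [coeff_diag, coeff_powSeries_pow hp, X_pow_eq]
  · rw [coeff_diag, coeff_powSeries_of_ne hn, map_zero]

theorem coeff_scalar_smul {k : Type*} [CommRing k] [Algebra k B] (r : k) (f : PowerSeries B)
    (n : ℕ) : coeff n (r • f) = r • coeff n f := rfl

theorem coeff_monomial_mul' (c m : ℕ) (x : B) (f : PowerSeries B) :
    coeff m (monomial c x * f) = if c ≤ m then x * coeff (m - c) f else 0 := by
  have : monomial c x = X ^ c * C x := by
    ext n
    rw [coeff_monomial, coeff_X_pow_mul', coeff_C]
    split_ifs <;> first | rfl | omega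
  rw [this, mul_assoc, coeff_X_pow_mul', coeff_C_mul]

end

end PowerSeries

namespace ArtinHasse

open PowerSeries

section
variable {k A : Type*} [CommRing k] [Ring A] [Algebra k A] (p : ℕ) [hp : Fact p.Prime]
  (E : PowerSeries k)

/-- The commutation rule between the two families of Artin–Hasse coefficients. -/
def Star (φ ψ : MvPolynomial ℕ k →ₐ[k] A) : Prop :=
  ∀ m n, ψ (theta p E n) * φ (theta p E m) = ∑ c ∈ Finset.range (min m n + 1),
    coeff c E • (φ (theta p E (m - c)) * ψ (theta p E (n - c)))

/-- The image of the generating series of `theta`. -/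
def imageSeries (φ : MvPolynomial ℕ k →ₐ[k] A) : PowerSeries A := map φ.toRingHom (thetaSeries p E)

/-- The central series `E (s * t)`. -/
def kernelSeries (A : Type*) [Ring A] [Algebra k A] : PowerSeries (PowerSeries A) :=
  diag (map (algebraMap k A) E)

theorem coeff_imageSeries (φ : MvPolynomial ℕ k →ₐ[k] A) (n : ℕ) :
    coeff n (imageSeries p E φ) = φ (theta p E n) := by
  rw [imageSeries, coeff_map, thetaSeries, coeff_mk]; rfl

theorem coeff_kernelSeries_mul_C (f : PowerSeries A) (n : ℕ) :
    coeff n (kernelSeries E A * C f) = coeff n E • (X ^ n * f) := by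
  rw [coeff_mul_C, kernelSeries, coeff_diag, coeff_map]
  ext m
  rw [coeff_monomial_mul', coeff_scalar_smul, coeff_X_pow_mul']
  split_ifs
  · rw [Algebra.smul_def]
  · rw [smul_zero]

theorem star_iff {φ ψ : MvPolynomial ℕ k →ₐ[k] A} : Star p E φ ψ ↔
    map C (imageSeries p E ψ) * C (imageSeries p E φ) =
      kernelSeries E A * C (imageSeries p E φ) * map C (imageSeries p E ψ) := by
  have h1 : ∀ m n, coeff m (coeff n (map C (imageSeries p E ψ) * C (imageSeries p E φ))) =
      ψ (theta p E n) * φ (theta p E m) := by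
    intro m n
    rw [coeff_mul_C, coeff_map, coeff_C_mul, coeff_imageSeries, coeff_imageSeries]
  have h2 : ∀ m n, coeff m (coeff n (kernelSeries E A * C (imageSeries p E φ) *
      map C (imageSeries p E ψ))) = ∑ c ∈ Finset.range (min m n + 1),
      coeff c E • (φ (theta p E (m - c)) * ψ (theta p E (n - c))) := by
    intro m n
    rw [coeff_mul, Finset.Nat.sum_antidiagonal_eq_sum_range_succ_mk, map_sum]
    symm
    refine Finset.sum_subset_zero_on_sdiff (fun x hx => ?_) (fun x hx => ?_) fun x hx => ?_
    · rw [Finset.mem_range] at hx ⊢; omega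
    · rw [coeff_kernelSeries_mul_C, coeff_map, coeff_mul_C, coeff_scalar_smul, coeff_X_pow_mul', if_neg,
        smul_zero, zero_mul]
      simp only [Finset.mem_sdiff, Finset.mem_range] at hx
      omega
    · rw [coeff_kernelSeries_mul_C, coeff_map, coeff_mul_C, coeff_scalar_smul, coeff_X_pow_mul', if_pos,
        coeff_imageSeries, coeff_imageSeries, smul_mul_assoc]
      rw [Finset.mem_range] at hx; omega
  constructor
  · intro h
    ext n m
    rw [h1, h2, h]
  · intro h m n
    rw [← h1, h, h2]

theorem commute_kernelSeries (f : PowerSeries (PowerSeries A)) : Commute (kernelSeries E A) f := by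
  refine commute_of_coeff fun i j => ?_
  rw [kernelSeries, coeff_diag, coeff_map]
  refine commute_of_coeff fun a b => ?_
  rw [coeff_monomial]
  split_ifs
  · exact Algebra.commutes _ _
  · exact Commute.zero_left _

theorem constantCoeff_imageSeries (φ : MvPolynomial ℕ k →ₐ[k] A) :
    constantCoeff (imageSeries p E φ) = 1 := by
  rw [← coeff_zero_eq_constantCoeff_apply, coeff_imageSeries, theta, map_one]

variable (hE : constantCoeff E = 1) (hE' : euler E = (powSeries p fun _ => (1 : k)) * E)
include hE hE'

theorem euler_imageSeries (φ : MvPolynomial ℕ k →ₐ[k] A) : euler (imageSeries p E φ) =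
    (powSeries p fun i => φ (wittPolynomial p k i)) * imageSeries p E φ := by
  rw [imageSeries, euler_map, euler_thetaSeries p E hE hE', map_mul, map_powSeries]
  rfl

/-- The commutation rule follows from the canonical commutation relations between the ghost
components. -/
theorem star_of_ghost [IsAddTorsionFree A] (φ ψ : MvPolynomial ℕ k →ₐ[k] A)
    (h : ∀ i j, ψ (wittPolynomial p k j) * φ (wittPolynomial p k i) =
      φ (wittPolynomial p k i) * ψ (wittPolynomial p k j) + if i = j then (p : A) ^ i else 0) :
    Star p E φ ψ := by
  have htf := isAddTorsionFree A
  have h2p := hp.out.two_le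
  rw [star_iff]
  set b := imageSeries p E φ with hb
  set a : PowerSeries (PowerSeries A) := map C (imageSeries p E ψ) with ha
  set Q : PowerSeries A := powSeries p fun i => φ (wittPolynomial p k i) with hQ
  set u := kernelSeries E A with hu
  have hQ0 : constantCoeff Q = 0 := constantCoeff_powSeries h2p _
  have hEb : euler b = Q * b := euler_imageSeries p E hE hE' φ
  have hXX : ∀ j (f : PowerSeries A), f * X ^ p ^ j = X ^ p ^ j * f :=
    fun j f => ((commute_X_pow f (p ^ j)).eq)
  have hEX : ∀ j, euler ((X : PowerSeries A) ^ p ^ j) = C ((p : A) ^ j) * X ^ p ^ j := by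
    intro j
    ext n
    rw [coeff_euler, coeff_C_mul, coeff_X_pow]
    split_ifs with h
    · rw [h]; push_cast; rfl
    · simp
  have hCQ : ∀ j, C (ψ (wittPolynomial p k j)) * Q =
      Q * C (ψ (wittPolynomial p k j)) + C ((p : A) ^ j) * X ^ p ^ j := by
    intro j
    rw [hQ, C_mul_powSeries, powSeries_mul_C]
    have : C ((p : A) ^ j) * X ^ p ^ j = powSeries p fun i => if i = j then (p : A) ^ i else 0 := by
      refine powSeries_ext h2p (fun i => ?_) fun n hn => ?_
      · rw [coeff_C_mul, coeff_X_pow]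
        by_cases hij : i = j
        · simp [hij]
        · rw [if_neg fun h => hij (Nat.pow_right_injective h2p h), if_neg hij, mul_zero]
      · rw [coeff_C_mul, coeff_X_pow, if_neg fun h => hn j h.symm, mul_zero]
    rw [this, powSeries_add]
    simp only [h]
  have hCb : ∀ j, C (ψ (wittPolynomial p k j)) * b =
      b * C (ψ (wittPolynomial p k j)) + X ^ p ^ j * b := by
    intro j
    rw [← sub_eq_zero]
    refine eq_zero_of_euler_eq hQ0 ?_ ?_
    · simp only [map_sub, map_add, map_mul, constantCoeff_C, hb, constantCoeff_imageSeries,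
        map_pow, constantCoeff_X]
      have : p ^ j ≠ 0 := pow_ne_zero _ hp.out.ne_zero
      simp [zero_pow this]
    · simp only [map_sub, map_add, euler_mul, euler_C, hEb, hEX, zero_mul, zero_add, mul_zero,
        add_zero]
      have hc : X ^ p ^ j * (Q * b) = Q * (X ^ p ^ j * b) := by
        rw [← mul_assoc, ← hXX, mul_assoc]
      rw [← mul_assoc (C _) Q b, hCQ, mul_sub, mul_add, hc]
      noncomm_ring
  set W : PowerSeries (PowerSeries A) :=
    powSeries p fun i => C (ψ (wittPolynomial p k i)) with hW
  set U : PowerSeries (PowerSeries A) := powSeries p fun i => X ^ p ^ i with hU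
  have hW0 : constantCoeff W = 0 := constantCoeff_powSeries h2p _
  have hEa : euler a = W * a := by
    rw [ha, euler_map, euler_imageSeries p E hE hE', map_mul, map_powSeries]
  have hEu : euler u = U * u := by
    rw [hu, kernelSeries, euler_diag, euler_map, hE', map_mul, map_mul, map_powSeries, map_one,
      diag_powSeries_one h2p]
  have hWb : W * C b = C b * W + U * C b := by
    rw [hW, hU, C_mul_powSeries, powSeries_mul_C, powSeries_mul_C, powSeries_add]
    simp only [hCb]
  have hWu : W * u = u * W := (commute_kernelSeries E W).eq.symm
  have hUu : U * u = u * U := (commute_kernelSeries E U).eq.symm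
  rw [← sub_eq_zero]
  refine eq_zero_of_euler_eq hW0 ?_ ?_
  · have e1 : constantCoeff a = 1 := by
      rw [← coeff_zero_eq_constantCoeff_apply, ha, coeff_map, coeff_zero_eq_constantCoeff_apply,
        constantCoeff_imageSeries, map_one]
    have e2 : constantCoeff u = 1 := by
      rw [← coeff_zero_eq_constantCoeff_apply, hu, kernelSeries, coeff_diag, coeff_map,
        coeff_zero_eq_constantCoeff_apply, hE, map_one, monomial_zero_eq_C_apply, map_one]
    rw [map_sub, map_mul, map_mul, map_mul, e1, e2]
    simp
  · rw [map_sub, euler_mul, euler_mul, euler_mul, euler_C, hEa, hEu, mul_zero, mul_zero, add_zero,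
      add_zero, mul_sub, ← mul_assoc W (u * C b) a, ← mul_assoc W u, hWu, mul_assoc u W, hWb, hUu]
    noncomm_ring

end

end ArtinHasse

namespace PowerSeries

section
variable (p : ℕ) [hp : Fact p.Prime]

theorem pow_eq_spread_frobenius {Z : Type*} [CommRing Z] [CharP Z p] (f : PowerSeries Z) :
    f ^ p = spread hp.out.ne_zero (map (frobenius Z p) f) := by
  have h : spread hp.out.ne_zero f = PowerSeries.expand p hp.out.ne_zero f := by
    ext n
    rw [coeff_spread, PowerSeries.coeff_expand]
  rw [spread_map, h]
  exact (MvPowerSeries.map_frobenius_expand p hp.out.ne_zero).symm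

theorem map_pow_eq_spread {Z A : Type*} [CommRing Z] [Ring A] [CharP A p] (g : Z →+* A)
    (f : PowerSeries Z) :
    (map g f) ^ p = spread hp.out.ne_zero (PowerSeries.mk fun n => g (coeff n f) ^ p) := by
  have hinj := RingHom.kerLift_injective g
  have : Nontrivial A := CharP.nontrivial_of_char_ne_one hp.out.ne_one
  have : Nontrivial (Z ⧸ RingHom.ker g) := (RingHom.kerLift g).domain_nontrivial
  have : CharP (Z ⧸ RingHom.ker g) p := (CharP.charP_iff_prime_eq_zero hp.out).2
    (hinj (by rw [map_natCast, CharP.cast_eq_zero, map_zero]))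
  have h1 : map g f = map (RingHom.kerLift g) (map (Ideal.Quotient.mk (RingHom.ker g)) f) := by
    ext n
    simp
  rw [h1, ← map_pow, pow_eq_spread_frobenius, ← spread_map]
  congr 1
  ext n
  simp [frobenius_def]

theorem diag_spread {B : Type*} [Ring B] (e : PowerSeries B) :
    diag (spread hp.out.ne_zero e) =
      spread hp.out.ne_zero (map (spread hp.out.ne_zero) (diag e)) := by
  ext1 n
  rw [coeff_diag, coeff_spread, coeff_spread, coeff_map, coeff_diag]
  split_ifs with h
  · obtain ⟨m, rfl⟩ := h
    rw [Nat.mul_div_cancel_left _ hp.out.pos]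
    ext i
    rw [coeff_spread, coeff_monomial]
    split_ifs with h1 h2 h2
    · rw [h1, Nat.mul_div_cancel_left _ hp.out.pos, coeff_monomial_same]
    · exact absurd (h1 ▸ dvd_mul_right p m) h2
    · obtain ⟨j, rfl⟩ := h2
      rw [Nat.mul_div_cancel_left _ hp.out.pos, coeff_monomial, if_neg]
      rintro rfl
      exact h1 rfl
    · rfl
  · rw [map_zero]

end

end PowerSeries

namespace ArtinHasse

open PowerSeries

section
variable {A : Type*} [Ring A] (p : ℕ) [hp : Fact p.Prime] [Algebra ℤ_[p] A]

theorem algebraMap_pow_prime [CharP A p] (r : ℤ_[p]) :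
    algebraMap ℤ_[p] A r ^ p = algebraMap ℤ_[p] A r := by
  have h : PadicInt.toZMod (r ^ p - r) = 0 := by
    rw [map_sub, map_pow, ZMod.pow_card, sub_self]
  have h' := (RingHom.mem_ker (f := PadicInt.toZMod)).2 h
  rw [PadicInt.ker_toZMod, PadicInt.maximalIdeal_eq_span_p, Ideal.mem_span_singleton] at h'
  obtain ⟨z, hz⟩ := h'
  rw [← sub_eq_zero, ← map_pow, ← map_sub, hz, map_mul, map_natCast, CharP.cast_eq_zero, zero_mul]

theorem apply_pow_prime [CharP A p] (ψ : MvPolynomial ℕ ℤ_[p] →ₐ[ℤ_[p]] A)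
    (f : MvPolynomial ℕ ℤ_[p]) : ψ f ^ p = ψ (MvPolynomial.expand p f) := by
  induction f using MvPolynomial.induction_on with
  | C r =>
    rw [MvPolynomial.expand_C, ← MvPolynomial.algebraMap_eq, AlgHom.commutes,
      algebraMap_pow_prime p]
  | add f g hf hg =>
    have hc : Commute (ψ f) (ψ g) := (Commute.all f g).map ψ
    rw [map_add, add_pow_char_of_commute p hc, hf, hg, map_add, map_add]
  | mul_X f i hf =>
    have hc : Commute (ψ f) (ψ (MvPolynomial.X i)) := (Commute.all f _).map ψ
    rw [map_mul, hc.mul_pow, hf, map_mul, map_mul, MvPolynomial.expand_X, map_pow]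

variable (E : PowerSeries ℤ_[p])

theorem imageSeries_pow_prime [CharP A p] (ψ : MvPolynomial ℕ ℤ_[p] →ₐ[ℤ_[p]] A) :
    imageSeries p E ψ ^ p =
      spread hp.out.ne_zero (imageSeries p E (ψ.comp (MvPolynomial.expand p))) := by
  rw [imageSeries, map_pow_eq_spread]
  congr 1
  ext n
  rw [coeff_mk, coeff_imageSeries, thetaSeries, coeff_mk]
  exact apply_pow_prime p ψ _

theorem kernelSeries_pow_prime [CharP A p] : kernelSeries E A ^ p =
    spread hp.out.ne_zero (map (spread hp.out.ne_zero) (kernelSeries E A)) := by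
  rw [kernelSeries, ← map_pow, map_pow_eq_spread, diag_spread]
  congr 3
  ext n
  rw [coeff_mk, coeff_map, algebraMap_pow_prime p]

variable {E} (hE : constantCoeff E = 1) (hE' : euler E = (powSeries p fun _ => (1 : ℤ_[p])) * E)
include hE hE'

omit hE hE' in
theorem Star.pow_left_aux [CharP A p] {φ ψ : MvPolynomial ℕ ℤ_[p] →ₐ[ℤ_[p]] A} (h : Star p E φ ψ) :
    map C (imageSeries p E (ψ.comp (MvPolynomial.expand p))) * C (imageSeries p E φ) =
      map (spread hp.out.ne_zero) (kernelSeries E A) * C (imageSeries p E φ) *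
        map C (imageSeries p E (ψ.comp (MvPolynomial.expand p))) := by
  rw [star_iff] at h
  have hn : ∀ n, map C (imageSeries p E ψ) ^ n * C (imageSeries p E φ) =
      kernelSeries E A ^ n * C (imageSeries p E φ) * map C (imageSeries p E ψ) ^ n := by
    intro n
    induction n with
    | zero => simp
    | succ n ih =>
      have hu := (commute_kernelSeries E (map C (imageSeries p E ψ) ^ n)).eq
      rw [pow_succ, mul_assoc, h, mul_assoc (kernelSeries E A), ← mul_assoc _ (kernelSeries E A),
        ← hu, mul_assoc, ← mul_assoc _ (C (imageSeries p E φ)), ih, pow_succ' (kernelSeries E A)]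
      simp only [mul_assoc]
  have hp' := hn p
  rw [← map_pow, imageSeries_pow_prime, kernelSeries_pow_prime, ← spread_map] at hp'
  apply spread_injective hp.out.ne_zero
  simpa only [map_mul, spread_C] using hp'

theorem Star.commute [CharP A p] {φ ψ : MvPolynomial ℕ ℤ_[p] →ₐ[ℤ_[p]] A} (h : Star p E φ ψ)
    (f : MvPolynomial ℕ ℤ_[p]) :
    Commute (φ (MvPolynomial.X 0)) (ψ (MvPolynomial.expand p f)) := by
  have h1 : ∀ n, Commute (φ (MvPolynomial.X 0)) (ψ (MvPolynomial.expand p (theta p E n))) := by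
    intro n
    have h2 := congrArg (fun F => coeff 1 (coeff n F)) (h.pow_left_aux p)
    rw [coeff_mul_C, coeff_map, coeff_C_mul, coeff_imageSeries, coeff_imageSeries,
      theta_one p E hE hE', coeff_mul, Finset.Nat.sum_antidiagonal_eq_sum_range_succ_mk,
      map_sum, Finset.sum_eq_single 0] at h2
    · rw [coeff_mul_C, coeff_map, coeff_map, coeff_mul_C, kernelSeries, coeff_diag, coeff_map,
        coeff_zero_eq_constantCoeff_apply, hE, map_one, monomial_zero_eq_C_apply, map_one, map_one,
        one_mul, coeff_imageSeries, coeff_imageSeries, theta_one p E hE hE'] at h2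
      exact h2.symm
    · intro c _ hc
      rw [coeff_mul_C, coeff_map, coeff_map, coeff_mul_C, kernelSeries, coeff_diag, coeff_mul,
        Finset.sum_eq_zero, zero_mul]
      rintro ⟨a, b⟩ hab
      rw [Finset.HasAntidiagonal.mem_antidiagonal] at hab
      dsimp only at hab ⊢
      rw [coeff_spread, coeff_monomial]
      split_ifs with h3 h4
      · obtain ⟨d, rfl⟩ := h3
        rw [Nat.mul_div_cancel_left _ hp.out.pos] at h4
        have := hp.out.two_le
        nlinarith [Nat.pos_of_ne_zero hc]
      · rw [zero_mul]
      · rw [zero_mul]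
    · intro h0
      simp at h0
  have h2 : f ∈ Algebra.adjoin ℤ_[p] (Set.range (theta p E)) := by
    rw [adjoin_range_theta p E hE hE']; trivial
  induction h2 using Algebra.adjoin_induction with
  | mem x hx => obtain ⟨n, rfl⟩ := hx; exact h1 n
  | algebraMap r =>
    rw [AlgHom.commutes, AlgHom.commutes]
    exact Algebra.commute_algebraMap_right r _
  | add x y _ _ hx hy => rw [map_add, map_add]; exact hx.add_right hy
  | mul x y _ _ hx hy => rw [map_mul, map_mul]; exact hx.mul_right hy

theorem Star.pow_left [CharP A p] {φ ψ : MvPolynomial ℕ ℤ_[p] →ₐ[ℤ_[p]] A} (h : Star p E φ ψ) :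
    Star p E (φ.comp (MvPolynomial.rename Nat.succ)) (ψ.comp (MvPolynomial.expand p)) := by
  have haux := h.pow_left_aux p
  have hcomm := h.commute p hE hE'
  rw [star_iff]
  set a1 : PowerSeries (PowerSeries A) :=
    map C (imageSeries p E (ψ.comp (MvPolynomial.expand p))) with ha1
  set b1 := imageSeries p E (φ.comp (MvPolynomial.rename Nat.succ)) with hb1
  set hd : PowerSeries A := map φ.toRingHom (thetaHead E) with hhd
  have hb : imageSeries p E φ = hd * spread hp.out.ne_zero b1 := by
    rw [imageSeries, thetaSeries_eq p E hE, map_mul, ← spread_map, hb1, imageSeries]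
    rfl
  have hunit : IsUnit hd := by
    refine IsUnit.map (map φ.toRingHom) (PowerSeries.isUnit_iff_constantCoeff.2 ?_)
    rw [← coeff_zero_eq_constantCoeff_apply, coeff_thetaHead, coeff_zero_eq_constantCoeff_apply, hE]
    simp
  have hc : Commute a1 (C hd) := by
    refine commute_of_coeff fun i j => ?_
    rw [ha1, coeff_map, coeff_C, coeff_imageSeries]
    split_ifs
    · refine commute_of_coeff fun a b => ?_
      rw [coeff_C, hhd, coeff_map, coeff_thetaHead]
      split_ifs
      · change Commute (ψ (MvPolynomial.expand p (theta p E i)))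
          (φ (MvPolynomial.C (coeff b E) * MvPolynomial.X 0 ^ b))
        rw [map_mul, map_pow, ← MvPolynomial.algebraMap_eq, AlgHom.commutes]
        exact (Algebra.commute_algebraMap_right _ _).mul_right ((hcomm _).symm.pow_right b)
      · exact Commute.zero_left _
    · exact Commute.zero_right _
  have hv : Commute (map (spread hp.out.ne_zero) (kernelSeries E A)) (C hd) := by
    refine commute_of_coeff fun i j => ?_
    rw [coeff_map, kernelSeries, coeff_diag, coeff_map]
    refine commute_of_coeff fun a b => ?_
    rw [coeff_spread, coeff_monomial]
    split_ifs
    · exact Algebra.commutes _ _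
    · exact Commute.zero_left _
    · exact Commute.zero_left _
  rw [hb, map_mul, ← mul_assoc, hc.eq, ← mul_assoc, hv.eq, mul_assoc, mul_assoc, mul_assoc] at haux
  have h3 := (hunit.map C).mul_left_cancel haux
  refine PowerSeries.map_injective (spread hp.out.ne_zero) (spread_injective hp.out.ne_zero) ?_
  have e1 : map (spread hp.out.ne_zero) a1 = a1 := by
    ext1 n
    rw [ha1, coeff_map, coeff_map, spread_C]
  rw [map_mul, map_mul, map_mul, e1, map_C]
  rw [h3, mul_assoc]

omit hE hE' in
theorem Star.op {φ ψ : MvPolynomial ℕ ℤ_[p] →ₐ[ℤ_[p]] A} (h : Star p E φ ψ) :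
    Star p E (ψ.toOpposite fun x y => (Commute.all x y).map ψ)
      (φ.toOpposite fun x y => (Commute.all x y).map φ) := by
  intro m n
  have := congrArg MulOpposite.op (h n m)
  rw [min_comm]
  simpa [← MulOpposite.op_mul] using this

omit hE hE' in
theorem Star.of_op {φ ψ : MvPolynomial ℕ ℤ_[p] →ₐ[ℤ_[p]] A}
    (h : Star p E (ψ.toOpposite fun x y => (Commute.all x y).map ψ)
      (φ.toOpposite fun x y => (Commute.all x y).map φ)) : Star p E φ ψ := by
  intro m n
  apply MulOpposite.op_injective
  have := h n m
  rw [min_comm] at this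
  simpa [← MulOpposite.op_mul] using this

theorem Star.pow_right [CharP A p] {φ ψ : MvPolynomial ℕ ℤ_[p] →ₐ[ℤ_[p]] A} (h : Star p E φ ψ) :
    Star p E (φ.comp (MvPolynomial.expand p)) (ψ.comp (MvPolynomial.rename Nat.succ)) := by
  have : CharP Aᵐᵒᵖ p := inferInstance
  exact Star.of_op p ((h.op p).pow_left p hE hE')

theorem Star.commute' [CharP A p] {φ ψ : MvPolynomial ℕ ℤ_[p] →ₐ[ℤ_[p]] A} (h : Star p E φ ψ)
    (f : MvPolynomial ℕ ℤ_[p]) :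
    Commute (ψ (MvPolynomial.X 0)) (φ (MvPolynomial.expand p f)) :=
  MulOpposite.op_injective ((h.op p).commute p hE hE' f).eq.symm

theorem Star.iterate [CharP A p] {φ ψ : MvPolynomial ℕ ℤ_[p] →ₐ[ℤ_[p]] A} (h : Star p E φ ψ)
    (r s : ℕ) : ∃ φ' ψ' : MvPolynomial ℕ ℤ_[p] →ₐ[ℤ_[p]] A, Star p E φ' ψ' ∧
      (∀ i, φ' (MvPolynomial.X i) = φ (MvPolynomial.X (r + i)) ^ p ^ s) ∧
      ∀ j, ψ' (MvPolynomial.X j) = ψ (MvPolynomial.X (s + j)) ^ p ^ r := by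
  induction r with
  | zero =>
    induction s with
    | zero => exact ⟨φ, ψ, h, fun i => by simp, fun j => by simp⟩
    | succ s ih =>
      obtain ⟨φ', ψ', h', h1, h2⟩ := ih
      refine ⟨_, _, h'.pow_right p hE hE', fun i => ?_, fun j => ?_⟩
      · simp [h1, ← pow_mul, pow_succ]
      · simp [h2, show s + (j + 1) = s + 1 + j by omega]
  | succ r ih =>
    obtain ⟨φ', ψ', h', h1, h2⟩ := ih
    refine ⟨_, _, h'.pow_left p hE hE', fun i => ?_, fun j => ?_⟩
    · simp [h1, show r + (i + 1) = r + 1 + i by omega]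
    · simp [h2, ← pow_mul, pow_succ]

end

end ArtinHasse

section

theorem map_ordProd {σ A B : Type*} [LinearOrder σ] [Ring A] [Ring B] (h : A →+* B) (x : σ → A)
    (e : σ →₀ ℕ) : h (ordProd x e) = ordProd (fun i => h (x i)) e := by
  simp [ordProd, map_list_prod, Function.comp_def]

theorem map_cEval {A B : Type*} [Ring A] [Ring B] (h : A →+* B) (x y : ℕ+ → A)
    (q : MvPolynomial (ℕ+ ⊕ₗ ℕ+) ℤ) :
    h (cEval x y q) = cEval (fun d => h (x d)) (fun e => h (y e)) q := by
  rw [cEval, cEval, pEval, pEval, map_sum]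
  refine Finset.sum_congr rfl fun e _ => ?_
  rw [map_zsmul, map_ordProd]
  congr 2
  funext v
  rcases ofLex v with d | d <;> rfl

theorem cEval_congr {A : Type*} [Ring A] {x y x' y' : ℕ+ → A} {q : MvPolynomial (ℕ+ ⊕ₗ ℕ+) ℤ}
    (h : ∀ v ∈ q.vars, Sum.elim x y (ofLex v) = Sum.elim x' y' (ofLex v)) :
    cEval x y q = cEval x' y' q := by
  rw [cEval, cEval, pEval, pEval]
  refine Finset.sum_congr rfl fun e he => ?_
  congr 1
  rw [ordProd, ordProd]
  congr 1
  refine List.map_congr_left fun v hv => ?_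
  rw [h v ((MvPolynomial.mem_vars_iff_mem_support v).2 ⟨e, he, by simpa using hv⟩)]

end

namespace Subalgebra

variable {k P : Type*} [CommRing k] [Ring P] [Algebra k P]

theorem list_prod_mem_mul {F G : Subalgebra k P} {x y : ℕ+ → P} (hx : ∀ d, x d ∈ F)
    (e : ℕ+ ⊕ₗ ℕ+ →₀ ℕ) (l : List (ℕ+ ⊕ₗ ℕ+)) (hs : l.Pairwise (· ≤ ·))
    (hy : ∀ d, toLex (Sum.inr d) ∈ l → y d ∈ G) :
    (l.map fun v => Sum.elim x y (ofLex v) ^ e v).prod ∈ toSubmodule F * toSubmodule G ∧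
    ((∀ v ∈ l, ∃ d, v = toLex (Sum.inr d)) →
      (l.map fun v => Sum.elim x y (ofLex v) ^ e v).prod ∈ G) := by
  have hle : ∀ g ∈ G, g ∈ toSubmodule F * toSubmodule G := fun g hg => by
    have := Submodule.mul_mem_mul (M := toSubmodule F) (N := toSubmodule G) F.one_mem hg
    rwa [one_mul] at this
  induction l with
  | nil => exact ⟨hle _ (by simp), fun _ => by simp⟩
  | cons v l ih =>
    rw [List.pairwise_cons] at hs
    obtain ⟨ih1, ih2⟩ := ih hs.2 fun d hd => hy d (List.mem_cons_of_mem _ hd)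
    rw [List.map_cons, List.prod_cons]
    rcases hv : ofLex v with d | d
    · refine ⟨?_, fun h => ?_⟩
      · have h2 := Submodule.mul_mem_mul (M := toSubmodule F)
          (F.pow_mem (hx d) (e v)) ih1
        rw [← mul_assoc, F.isIdempotentElem_toSubmodule.eq] at h2
        simpa [hv] using h2
      · obtain ⟨d', hd'⟩ := h v (List.mem_cons_self)
        rw [hd'] at hv
        simp at hv
    · have hv' : v = toLex (Sum.inr d) := by rw [← hv]; rfl
      have hall : ∀ w ∈ l, ∃ d, w = toLex (Sum.inr d) := by
        intro w hw
        have h3 := hs.1 w hw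
        rw [hv'] at h3
        rcases hw' : ofLex w with d' | d'
        · have : w = toLex (Sum.inl d') := by rw [← hw']; rfl
          rw [this] at h3
          exact absurd h3 Sum.Lex.not_inr_le_inl
        · exact ⟨d', by rw [← hw']; rfl⟩
      have h4 := G.mul_mem (G.pow_mem (hy d (by rw [← hv']; exact List.mem_cons_self)) (e v))
        (ih2 hall)
      have h5 : Sum.elim x y (ofLex v) = y d := by rw [hv]; rfl
      rw [← hv, h5]
      exact ⟨hle _ h4, fun _ => h4⟩

theorem cEval_mem_mul {F G : Subalgebra k P} {x y : ℕ+ → P} {q : MvPolynomial (ℕ+ ⊕ₗ ℕ+) ℤ}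
    (hx : ∀ d, x d ∈ F) (hy : ∀ d, toLex (Sum.inr d) ∈ q.vars → y d ∈ G) :
    cEval x y q ∈ toSubmodule F * toSubmodule G := by
  rw [cEval, pEval]
  refine Submodule.sum_mem _ fun e he => zsmul_mem ?_ _
  refine (list_prod_mem_mul hx e _ (Finset.pairwise_sort _ _) fun d hd => hy d ?_).1
  exact (MvPolynomial.mem_vars_iff_mem_support _).2 ⟨e, he, by simpa using hd⟩

theorem mul_mem_mul_of_adjoin {F : Subalgebra k P} {T : Set P}
    (h : ∀ t ∈ T, ∀ f ∈ F, t * f ∈ toSubmodule F * toSubmodule (Algebra.adjoin k T)) :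
    ∀ g ∈ Algebra.adjoin k T, ∀ f ∈ F, g * f ∈ toSubmodule F * toSubmodule (Algebra.adjoin k T) := by
  set G := Algebra.adjoin k T
  have hF : ∀ f ∈ F, f ∈ toSubmodule F * toSubmodule G := fun f hf => by
    have := Submodule.mul_mem_mul (M := toSubmodule F) (N := toSubmodule G) hf G.one_mem
    rwa [mul_one] at this
  intro g hg
  induction hg using Algebra.adjoin_induction with
  | mem t ht => exact h t ht
  | algebraMap r => exact fun f hf => hF _ (F.mul_mem (F.algebraMap_mem r) hf)
  | add a b _ _ ha hb => exact fun f hf => by rw [add_mul]; exact add_mem (ha f hf) (hb f hf)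
  | mul a b _ _ ha hb =>
    intro f hf
    rw [mul_assoc]
    refine Submodule.mul_induction_on (hb f hf) (fun f' hf' g' hg' => ?_) fun u v hu hv => ?_
    · rw [← mul_assoc]
      have := Submodule.mul_mem_mul (ha f' hf') hg'
      rwa [mul_assoc (toSubmodule F), G.isIdempotentElem_toSubmodule.eq] at this
    · rw [mul_add]; exact add_mem hu hv

theorem mul_mem_mul_of_commutator {x y : ℕ → P}
    (h : ∀ i j, y j * x i - x i * y j ∈ toSubmodule (Algebra.adjoin k (Set.range x)) *
      toSubmodule (Algebra.adjoin k (y '' Set.Iio j))) :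
    ∀ g ∈ Algebra.adjoin k (Set.range y), ∀ f ∈ Algebra.adjoin k (Set.range x),
      g * f ∈ toSubmodule (Algebra.adjoin k (Set.range x)) *
        toSubmodule (Algebra.adjoin k (Set.range y)) := by
  set F := Algebra.adjoin k (Set.range x)
  set G : ℕ → Subalgebra k P := fun j => Algebra.adjoin k (y '' Set.Iio j) with hG
  have hcomm : ∀ j, (∀ g ∈ G j, ∀ f ∈ F, g * f ∈ toSubmodule F * toSubmodule (G j)) →
      ∀ f ∈ F, y j * f - f * y j ∈ toSubmodule F * toSubmodule (G j) := by
    intro j hj f hf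
    induction hf using Algebra.adjoin_induction with
    | mem f hf => obtain ⟨i, rfl⟩ := hf; exact h i j
    | algebraMap r => rw [Algebra.commutes, sub_self]; exact zero_mem _
    | add a b _ _ ha hb =>
      rw [show y j * (a + b) - (a + b) * y j = (y j * a - a * y j) + (y j * b - b * y j) by
        noncomm_ring]
      exact add_mem ha hb
    | mul a b ha' hb' ha hb =>
      rw [show y j * (a * b) - a * b * y j = (y j * a - a * y j) * b + a * (y j * b - b * y j) by
        noncomm_ring]
      refine add_mem ?_ ?_
      · refine Submodule.mul_induction_on ha (fun f' hf' g' hg' => ?_) fun u v hu hv => ?_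
        · have := Submodule.mul_mem_mul (M := toSubmodule F) hf' (hj g' hg' b hb')
          rwa [← mul_assoc, F.isIdempotentElem_toSubmodule.eq, ← mul_assoc] at this
        · rw [add_mul]; exact add_mem hu hv
      · have := Submodule.mul_mem_mul (M := toSubmodule F) ha' hb
        rwa [← mul_assoc, F.isIdempotentElem_toSubmodule.eq] at this
  have hmono : ∀ G₁ G₂ : Subalgebra k P, G₁ ≤ G₂ →
      toSubmodule F * toSubmodule G₁ ≤ toSubmodule F * toSubmodule G₂ := by
    intro G₁ G₂ hle
    refine Submodule.mul_le.2 fun f hf g hg => Submodule.mul_mem_mul hf (hle hg)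
  have hgen : ∀ j, (∀ g ∈ G j, ∀ f ∈ F, g * f ∈ toSubmodule F * toSubmodule (G j)) →
      ∀ {G' : Subalgebra k P}, G j ≤ G' → y j ∈ G' →
      ∀ f ∈ F, y j * f ∈ toSubmodule F * toSubmodule G' := by
    intro j hj G' hle hy f hf
    have h1 := hmono _ _ hle (hcomm j hj f hf)
    have h2 := Submodule.mul_mem_mul (M := toSubmodule F) (N := toSubmodule G') hf hy
    rw [← sub_add_cancel (y j * f) (f * y j)]
    exact add_mem h1 h2
  have hall : ∀ j, ∀ g ∈ G j, ∀ f ∈ F, g * f ∈ toSubmodule F * toSubmodule (G j) := by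
    intro j
    induction j using Nat.strong_induction_on with
    | _ j ih =>
    refine mul_mem_mul_of_adjoin ?_
    rintro _ ⟨i, hi, rfl⟩
    exact hgen i (ih i hi) (Algebra.adjoin_mono (Set.image_mono (Set.Iio_subset_Iio hi.le)))
      (Algebra.subset_adjoin ⟨i, hi, rfl⟩)
  refine mul_mem_mul_of_adjoin ?_
  rintro _ ⟨j, rfl⟩
  exact hgen j (hall j) (Algebra.adjoin_mono (Set.image_subset_range _ _))
    (Algebra.subset_adjoin ⟨j, rfl⟩)

theorem mul_mem_mul_of_span {S T : Set P}
    (h : ∀ t ∈ T, ∀ s ∈ S, t * s ∈ toSubmodule (Algebra.adjoin k S) * Submodule.span k T) :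
    ∀ g ∈ Algebra.adjoin k T, ∀ f ∈ Algebra.adjoin k S,
      g * f ∈ toSubmodule (Algebra.adjoin k S) * toSubmodule (Algebra.adjoin k T) := by
  set F := Algebra.adjoin k S
  set H := Submodule.span k T
  have key : ∀ f ∈ F, ∀ t ∈ H, t * f ∈ toSubmodule F * H := by
    intro f hf
    induction hf using Algebra.adjoin_induction with
    | mem s hs =>
      intro t ht
      induction ht using Submodule.span_induction with
      | mem t ht => exact h t ht s hs
      | zero => rw [zero_mul]; exact zero_mem _
      | add a b _ _ ha hb => rw [add_mul]; exact add_mem ha hb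
      | smul r a _ ha => rw [smul_mul_assoc]; exact Submodule.smul_mem _ _ ha
    | algebraMap r =>
      intro t ht
      rw [← Algebra.commutes]
      exact Submodule.mul_mem_mul (M := toSubmodule F) (F.algebraMap_mem r) ht
    | add a b _ _ ha hb =>
      intro t ht
      rw [mul_add]; exact add_mem (ha t ht) (hb t ht)
    | mul a b _ _ ha hb =>
      intro t ht
      rw [← mul_assoc]
      refine Submodule.mul_induction_on (ha t ht) (fun f' hf' t' ht' => ?_) fun u v hu hv => ?_
      · have := Submodule.mul_mem_mul (M := toSubmodule F) hf' (hb t' ht')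
        rwa [← mul_assoc, F.isIdempotentElem_toSubmodule.eq, ← mul_assoc] at this
      · rw [add_mul]; exact add_mem hu hv
  refine mul_mem_mul_of_adjoin fun t ht f hf => ?_
  exact mul_le_mul_right (Algebra.span_le_adjoin k T) _
    (key f hf t (Submodule.subset_span ht))

end Subalgebra

namespace AlgHom

open TensorProduct

variable {k S T A : Type*} [CommRing k] [CommRing S] [CommRing T] [Ring A]
  [Algebra k S] [Algebra k T] [Algebra k A]

/-- The linear map `f ⊗ g ↦ φ f * ψ g`, for algebra maps whose images need not commute. -/
def mulTensor (φ : S →ₐ[k] A) (ψ : T →ₐ[k] A) : S ⊗[k] T →ₗ[k] A :=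
  LinearMap.mul' k A ∘ₗ TensorProduct.map φ.toLinearMap ψ.toLinearMap

@[simp]
theorem mulTensor_tmul (φ : S →ₐ[k] A) (ψ : T →ₐ[k] A) (f : S) (g : T) :
    mulTensor φ ψ (f ⊗ₜ g) = φ f * ψ g := rfl

theorem mulTensor_comp {B : Type*} [Ring B] [Algebra k B] (h : A →ₐ[k] B)
    (φ : S →ₐ[k] A) (ψ : T →ₐ[k] A) (z : S ⊗[k] T) :
    mulTensor (h.comp φ) (h.comp ψ) z = h (mulTensor φ ψ z) := by
  induction z using TensorProduct.induction_on with
  | zero => simp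
  | tmul f g => simp
  | add a b ha hb => rw [map_add, map_add, map_add, ha, hb]

theorem exists_mulTensor_eq (φ : S →ₐ[k] A) (ψ : T →ₐ[k] A) {a : A}
    (ha : a ∈ Subalgebra.toSubmodule φ.range * Subalgebra.toSubmodule ψ.range) :
    ∃ z, mulTensor φ ψ z = a := by
  have hle : Subalgebra.toSubmodule φ.range * Subalgebra.toSubmodule ψ.range ≤
      LinearMap.range (mulTensor φ ψ) := by
    rw [Submodule.mul_le]
    rintro _ ⟨f, rfl⟩ _ ⟨g, rfl⟩
    exact ⟨f ⊗ₜ g, rfl⟩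
  exact hle ha

/-- An element of `φ(S)ψ(T)` in a product vanishes as soon as its second coordinate does, provided
that the second coordinate is free on `S ⊗ T`. -/
theorem eq_zero_of_mem_mul {M : Type*} [Ring M] [Algebra k M] {φ : S →ₐ[k] A} {ψ : T →ₐ[k] A}
    {φ' : S →ₐ[k] M} {ψ' : T →ₐ[k] M} (hinj : Function.Injective (mulTensor φ' ψ')) {z : A × M}
    (hz : z ∈ Subalgebra.toSubmodule (φ.prod φ').range * Subalgebra.toSubmodule (ψ.prod ψ').range)
    (h2 : z.2 = 0) : z.1 = 0 := by
  obtain ⟨t, rfl⟩ := exists_mulTensor_eq _ _ hz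
  have h3 := mulTensor_comp (AlgHom.snd k A M) (φ.prod φ') (ψ.prod ψ') t
  rw [AlgHom.snd_prod, AlgHom.snd_prod] at h3
  have h4 : t = 0 := hinj (by rw [h3, map_zero]; exact h2)
  rw [h4, map_zero]; rfl

theorem range_eq_adjoin (φ : MvPolynomial ℕ k →ₐ[k] A) :
    φ.range = Algebra.adjoin k (Set.range fun i => φ (MvPolynomial.X i)) := by
  rw [← Algebra.map_top, ← MvPolynomial.adjoin_range_X, AlgHom.map_adjoin, ← Set.range_comp]
  rfl

end AlgHom

namespace ArtinHasse

open PowerSeries AlgHom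

variable {k A M : Type*} [CommRing k] [Ring A] [Algebra k A] [Ring M] [Algebra k M]
  (p : ℕ) [hp : Fact p.Prime]

/-- The commutation relations `[ψ X_j, φ X_i] = c_{i,j}(φ X, ψ X)`. -/
def CRel (c : ℕ+ → ℕ+ → MvPolynomial (ℕ+ ⊕ₗ ℕ+) ℤ) (φ ψ : MvPolynomial ℕ k →ₐ[k] A) : Prop :=
  ∀ i j, ψ (.X j) * φ (.X i) - φ (.X i) * ψ (.X j) =
    cEval (fun d => φ (.X (padicValNat p d))) (fun e => ψ (.X (padicValNat p e)))
      (c (ppow p i) (ppow p j))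

variable {p}

theorem ppow_coe (i : ℕ) : (ppow p i : ℕ) = p ^ i :=
  Nat.toPNat'_coe (n := p ^ i) ▸ if_pos (pow_pos hp.out.pos i)

theorem eq_ppow_of_dvd {d : ℕ+} {i : ℕ} (h : (d : ℕ) ∣ (ppow p i : ℕ)) :
    d = ppow p (padicValNat p d) := by
  rw [ppow_coe, Nat.dvd_prime_pow hp.out] at h
  obtain ⟨m, -, hm⟩ := h
  rw [← PNat.coe_inj, ppow_coe, hm, padicValNat.prime_pow]

theorem padicValNat_lt {d : ℕ+} {i : ℕ} (h : (d : ℕ) ∣ (ppow p i : ℕ)) (hd : d ≠ ppow p i) :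
    padicValNat p d < i := by
  rw [ppow_coe, Nat.dvd_prime_pow hp.out] at h
  obtain ⟨m, hm, hm'⟩ := h
  rw [hm', padicValNat.prime_pow]
  refine lt_of_le_of_ne hm ?_
  rintro rfl
  exact hd (by rw [← PNat.coe_inj, ppow_coe, hm'])

variable {c : ℕ+ → ℕ+ → MvPolynomial (ℕ+ ⊕ₗ ℕ+) ℤ} (hc : IsCFamily c)
include hc

theorem padicValNat_lt_of_mem_vars {i j : ℕ} {e : ℕ+}
    (he : toLex (Sum.inr e) ∈ (c (ppow p i) (ppow p j)).vars) : padicValNat p e < j := by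
  rcases (hc _ _).1 _ he with ⟨d, -, -, h⟩ | ⟨d, h1, h2, h⟩
  · simp at h
  · obtain rfl : e = d := by simpa using h
    exact padicValNat_lt h1 h2

theorem CRel.cEval_mem {φ ψ : MvPolynomial ℕ k →ₐ[k] A} (i j : ℕ) :
    cEval (fun d => φ (.X (padicValNat p d))) (fun e => ψ (.X (padicValNat p e)))
      (c (ppow p i) (ppow p j)) ∈ 
      Subalgebra.toSubmodule (Algebra.adjoin k (Set.range fun i => φ (.X i))) *
      Subalgebra.toSubmodule (Algebra.adjoin k ((fun i => ψ (.X i)) '' Set.Iio j)) := by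
  refine Subalgebra.cEval_mem_mul (fun d => Algebra.subset_adjoin ⟨_, rfl⟩) fun d hd =>
    Algebra.subset_adjoin ⟨_, ?_, rfl⟩
  exact padicValNat_lt_of_mem_vars hc hd

omit hc hp in
theorem CRel.prod {φ ψ : MvPolynomial ℕ k →ₐ[k] A} {φ' ψ' : MvPolynomial ℕ k →ₐ[k] M}
    (h : CRel p c φ ψ) (h' : CRel p c φ' ψ') : CRel p c (φ.prod φ') (ψ.prod ψ') := by
  intro i j
  refine Prod.ext ?_ ?_
  · have := map_cEval (RingHom.fst A M) (fun d => φ.prod φ' (.X (padicValNat p d)))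
      (fun e => ψ.prod ψ' (.X (padicValNat p e))) (c (ppow p i) (ppow p j))
    exact (h i j).trans this.symm
  · have := map_cEval (RingHom.snd A M) (fun d => φ.prod φ' (.X (padicValNat p d)))
      (fun e => ψ.prod ψ' (.X (padicValNat p e))) (c (ppow p i) (ppow p j))
    exact (h' i j).trans this.symm

theorem CRel.star {E : PowerSeries k} {φ ψ : MvPolynomial ℕ k →ₐ[k] A}
    {φ' ψ' : MvPolynomial ℕ k →ₐ[k] M} (hinj : Function.Injective (mulTensor φ' ψ'))
    (h : CRel p c φ ψ) (h' : CRel p c φ' ψ') (hs : Star p E φ' ψ') : Star p E φ ψ := by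
  intro m n
  have hP := h.prod h'
  have key := Subalgebra.mul_mem_mul_of_commutator (k := k)
    (x := fun i => φ.prod φ' (.X i)) (y := fun j => ψ.prod ψ' (.X j)) fun i j => by
      rw [hP i j]; exact CRel.cEval_mem hc i j
  rw [← range_eq_adjoin, ← range_eq_adjoin] at key
  have h1 := key (ψ.prod ψ' (theta p E n)) ⟨_, rfl⟩ (φ.prod φ' (theta p E m)) ⟨_, rfl⟩
  have h2 := sub_mem h1 (Submodule.sum_mem _ (t := Finset.range (min m n + 1))
    (f := fun c => coeff c E • (φ.prod φ' (theta p E (m-c)) * ψ.prod ψ' (theta p E (n-c))))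
    fun c _ => Submodule.smul_mem _ _ (Submodule.mul_mem_mul (AlgHom.mem_range_self _ _)
      (AlgHom.mem_range_self _ _)))
  have h3 := eq_zero_of_mem_mul hinj h2 (by
    rw [Prod.snd_sub, Prod.snd_sum, sub_eq_zero]; exact hs m n)
  rw [Prod.fst_sub, Prod.fst_sum, sub_eq_zero] at h3
  exact h3

omit hc in
theorem Star.cRel {E : PowerSeries k} (hE : constantCoeff E = 1)
    (hE' : euler E = (powSeries p fun _ => (1 : k)) * E) {φ ψ : MvPolynomial ℕ k →ₐ[k] A}
    {φ' ψ' : MvPolynomial ℕ k →ₐ[k] M} (hinj : Function.Injective (mulTensor φ' ψ'))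
    (h : Star p E φ ψ) (h' : Star p E φ' ψ') (hs : CRel p c φ' ψ') : CRel p c φ ψ := by
  intro i j
  have hrange : ∀ χ : MvPolynomial ℕ k →ₐ[k] A × M,
      χ.range = Algebra.adjoin k (Set.range fun i => χ (theta p E i)) := fun χ => by
    rw [← Algebra.map_top, ← adjoin_range_theta p E hE hE', AlgHom.map_adjoin, ← Set.range_comp]
    rfl
  have key := Subalgebra.mul_mem_mul_of_span (k := k)
    (S := Set.range fun i => φ.prod φ' (theta p E i))
    (T := Set.range fun i => ψ.prod ψ' (theta p E i)) (by
      rintro _ ⟨n, rfl⟩ _ ⟨m, rfl⟩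
      have : ψ.prod ψ' (theta p E n) * φ.prod φ' (theta p E m) =
        ∑ c ∈ Finset.range (min m n + 1), coeff c E •
          (φ.prod φ' (theta p E (m-c)) * ψ.prod ψ' (theta p E (n-c))) := by
        refine Prod.ext ?_ ?_
        · rw [Prod.fst_sum]; exact h m n
        · rw [Prod.snd_sum]; exact h' m n
      rw [this]
      exact Submodule.sum_mem _ fun c _ => Submodule.smul_mem _ _ (Submodule.mul_mem_mul
        (Algebra.subset_adjoin ⟨_, rfl⟩) (Submodule.subset_span ⟨_, rfl⟩)))
  rw [← hrange, ← hrange] at key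
  have h1 := key (ψ.prod ψ' (.X j)) ⟨_, rfl⟩ (φ.prod φ' (.X i)) ⟨_, rfl⟩
  have h2 := sub_mem h1 (Submodule.mul_mem_mul (M := Subalgebra.toSubmodule (φ.prod φ').range)
    (N := Subalgebra.toSubmodule (ψ.prod ψ').range) ⟨.X i, rfl⟩ ⟨.X j, rfl⟩)
  have h3 : cEval (fun d => φ.prod φ' (.X (padicValNat p d)))
      (fun e => ψ.prod ψ' (.X (padicValNat p e))) (c (ppow p i) (ppow p j)) ∈
      Subalgebra.toSubmodule (φ.prod φ').range * Subalgebra.toSubmodule (ψ.prod ψ').range :=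
    Subalgebra.cEval_mem_mul (fun d => ⟨_, rfl⟩) fun d _ => ⟨_, rfl⟩
  have h4 := map_cEval (RingHom.fst A M) (fun d => φ.prod φ' (.X (padicValNat p d)))
      (fun e => ψ.prod ψ' (.X (padicValNat p e))) (c (ppow p i) (ppow p j))
  have h5 := map_cEval (RingHom.snd A M) (fun d => φ.prod φ' (.X (padicValNat p d)))
      (fun e => ψ.prod ψ' (.X (padicValNat p e))) (c (ppow p i) (ppow p j))
  have h6 := eq_zero_of_mem_mul hinj (sub_mem h2 h3) (by
    rw [Prod.snd_sub, sub_eq_zero]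
    exact (hs i j).trans h5.symm)
  rw [Prod.fst_sub, sub_eq_zero] at h6
  exact h6.trans h4

end ArtinHasse

section

variable {A B : Type*} [Ring A] [Ring B]

theorem map_ghost (h : A →+* B) (g : ℕ+ → A) (k : ℕ+) :
    h (ghost g k) = ghost (fun d => h (g d)) k := by
  simp [ghost]

theorem ghost_eq_sum (g : ℕ+ → A) (k : ℕ+) :
    ghost g k = ∑ d ∈ (k : ℕ).divisors, (d : A) * g d.toPNat' ^ ((k : ℕ) / d) := by
  rw [ghost, ← Finset.sum_attach (k : ℕ).divisors]
  refine Finset.sum_congr rfl fun d _ => ?_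
  have : (⟨(d : ℕ), Nat.pos_of_mem_divisors d.2⟩ : ℕ+) = (d : ℕ).toPNat' := by
    apply PNat.coe_inj.1
    rw [Nat.toPNat'_coe, if_pos (Nat.pos_of_mem_divisors d.2), PNat.mk_coe]
  rw [this]

theorem ghost_ppow (p : ℕ) [hp : Fact p.Prime] (g : ℕ+ → A) (n : ℕ) : ghost g (ppow p n) =
    ∑ i ∈ Finset.range (n + 1), (p : A) ^ i * g (ppow p i) ^ p ^ (n - i) := by
  rw [ghost_eq_sum, ArtinHasse.ppow_coe, Nat.sum_divisors_prime_pow hp.out]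
  refine Finset.sum_congr rfl fun i hi => ?_
  rw [Nat.pow_div (Finset.mem_range_succ_iff.1 hi) hp.out.pos, Nat.cast_pow]
  rfl

/-- The element of a `ℚ`-algebra with prescribed ghost components. -/
def ghostInv {Q : Type*} [CommRing Q] [Algebra ℚ Q] (w : ℕ+ → Q) (k : ℕ+) : Q :=
  ((k : ℕ) : ℚ)⁻¹ • (w k - ∑ d ∈ (k : ℕ).properDivisors.attach,
    ((d : ℕ) : Q) *
      ghostInv w ⟨(d : ℕ), Nat.pos_of_mem_properDivisors d.2⟩ ^ ((k : ℕ) / (d : ℕ)))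
termination_by (k : ℕ)
decreasing_by exact (Nat.mem_properDivisors.1 d.2).2

theorem ghost_ghostInv {Q : Type*} [CommRing Q] [Algebra ℚ Q] (w : ℕ+ → Q) (k : ℕ+) :
    ghost (ghostInv w) k = w k := by
  have hk : (k : ℕ).toPNat' = k := by
    apply PNat.coe_inj.1
    rw [Nat.toPNat'_coe, if_pos k.pos]
  have hsum : ∑ d ∈ (k : ℕ).properDivisors.attach, ((d : ℕ) : Q) *
      ghostInv w ⟨(d : ℕ), Nat.pos_of_mem_properDivisors d.2⟩ ^ ((k : ℕ) / (d : ℕ)) =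
      ∑ d ∈ (k : ℕ).properDivisors, (d : Q) * ghostInv w d.toPNat' ^ ((k : ℕ) / d) := by
    rw [← Finset.sum_attach (k : ℕ).properDivisors]
    refine Finset.sum_congr rfl fun d _ => ?_
    have : (⟨(d : ℕ), Nat.pos_of_mem_properDivisors d.2⟩ : ℕ+) = (d : ℕ).toPNat' := by
      apply PNat.coe_inj.1
      rw [Nat.toPNat'_coe, if_pos (Nat.pos_of_mem_properDivisors d.2), PNat.mk_coe]
    rw [this]
  have hself : ((k : ℕ) : Q) * ghostInv w k = w k -
      ∑ d ∈ (k : ℕ).properDivisors, (d : Q) * ghostInv w d.toPNat' ^ ((k : ℕ) / d) := by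
    rw [ghostInv, hsum, ← nsmul_eq_mul, ← Nat.cast_smul_eq_nsmul ℚ, smul_smul,
      mul_inv_cancel₀ (Nat.cast_ne_zero.2 k.ne_zero), one_smul]
  rw [ghost_eq_sum, ← Nat.cons_self_properDivisors k.ne_zero, Finset.sum_cons, hk,
    Nat.div_self k.pos, pow_one, hself, sub_add_cancel]

end

namespace MvPolynomial

open scoped IsMulCommutative in
/-- The algebra map from a polynomial ring determined by a commuting family. -/
theorem exists_algHom_of_commute {σ k A : Type*} [CommRing k] [Ring A] [Algebra k A] {x : σ → A}
    (hx : ∀ i j, x i * x j = x j * x i) :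
    ∃ φ : MvPolynomial σ k →ₐ[k] A, ∀ i, φ (X i) = x i := by
  have := Algebra.isMulCommutative_adjoin k (s := Set.range x) (by
    rintro _ ⟨i, rfl⟩ _ ⟨j, rfl⟩
    exact hx i j)
  refine ⟨(Algebra.adjoin k (Set.range x)).val.comp
    (aeval (S₁ := Algebra.adjoin k (Set.range x))
      fun i => ⟨x i, Algebra.subset_adjoin ⟨i, rfl⟩⟩), fun i => ?_⟩
  simp

end MvPolynomial

theorem IsCFamily.cEval_eq {c : ℕ+ → ℕ+ → MvPolynomial (ℕ+ ⊕ₗ ℕ+) ℤ} (hc : IsCFamily c)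
    {M : Type*} [Ring M] [Algebra ℚ M] {x y : ℕ+ → M}
    (hxx : ∀ k l, ghost x k * ghost x l = ghost x l * ghost x k)
    (hyy : ∀ k l, ghost y k * ghost y l = ghost y l * ghost y k)
    (hyx : ∀ k l, ghost y l * ghost x k =
      ghost x k * ghost y l + if k = l then ((k : ℕ) : M) else 0) (m n : ℕ+) :
    cEval x y (c m n) = y n * x m - x m * y n := by
  set f : FreeAlgebra ℚ (ℕ+ ⊕ ℕ+) →ₐ[ℚ] M := FreeAlgebra.lift ℚ (Sum.elim x y) with hf
  have hfx : ∀ d, f (bXf d) = x d := fun d => by simp [hf, bXf]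
  have hfy : ∀ d, f (bYf d) = y d := fun d => by simp [hf, bYf]
  have hgx : ∀ k, f (ghost bXf k) = ghost x k := fun k => by
    refine (map_ghost (f : FreeAlgebra ℚ (ℕ+ ⊕ ℕ+) →+* M) _ k).trans ?_
    congr 1; funext d; exact hfx d
  have hgy : ∀ k, f (ghost bYf k) = ghost y k := fun k => by
    refine (map_ghost (f : FreeAlgebra ℚ (ℕ+ ⊕ ℕ+) →+* M) _ k).trans ?_
    congr 1; funext d; exact hfy d
  have hrel : ∀ ⦃a b⦄, BRel a b → f a = f b := by
    intro a b hab
    cases hab with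
    | xx k l => rw [map_mul, map_mul, hgx, hgx, hxx]
    | yy k l => rw [map_mul, map_mul, hgy, hgy, hyy]
    | yx k l =>
      rw [map_add, map_mul, map_mul, hgx, hgy, hyx]
      congr 1
      split_ifs
      · rw [map_natCast]
      · rw [map_zero]
  set h : BQ →ₐ[ℚ] M := RingQuot.liftAlgHom ℚ ⟨f, hrel⟩ with hh
  have hx : ∀ d, h (bx d) = x d := fun d => by
    rw [hh, bx, RingQuot.liftAlgHom_mkAlgHom_apply, hfx]
  have hy : ∀ d, h (by' d) = y d := fun d => by
    rw [hh, by', RingQuot.liftAlgHom_mkAlgHom_apply, hfy]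
  have h1 := congrArg h (hc m n).2
  rw [map_sub, map_mul, map_mul, hx, hy] at h1
  rw [← h1]
  refine ((map_cEval (h : BQ →+* M) bx by' (c m n)).trans ?_).symm
  congr 1
  · funext d; exact hx d
  · funext d; exact hy d

namespace ArtinHasse

variable {p : ℕ} [hp : Fact p.Prime] {c : ℕ+ → ℕ+ → MvPolynomial (ℕ+ ⊕ₗ ℕ+) ℤ} (hc : IsCFamily c)
include hc

theorem cEval_ppow {A : Type*} [Ring A] (x y : ℕ+ → A) (i j : ℕ) :
    cEval (fun d => x (ppow p (padicValNat p d))) (fun e => y (ppow p (padicValNat p e)))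
      (c (ppow p i) (ppow p j)) = cEval x y (c (ppow p i) (ppow p j)) := by
  refine cEval_congr fun v hv => ?_
  rcases (hc _ _).1 v hv with ⟨d, hd, -, h⟩ | ⟨d, hd, -, h⟩
  · rw [h]; exact congrArg x (eq_ppow_of_dvd hd).symm
  · rw [h]; exact congrArg y (eq_ppow_of_dvd hd).symm

end ArtinHasse

namespace MvPolynomial

theorem pderiv_pderiv_comm {σ R : Type*} [CommRing R] (i j : σ) (f : MvPolynomial σ R) :
    pderiv i (pderiv j f) = pderiv j (pderiv i f) := by
  classical
  let D (i : σ) : Derivation R (MvPolynomial σ R) (MvPolynomial σ R) := pderiv i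
  have h : ⁅D i, D j⁆ = 0 := by
    refine derivation_ext fun l => ?_
    rw [Derivation.commutator_apply]
    change pderiv i (pderiv j (X l)) - pderiv j (pderiv i (X l)) = 0
    rw [pderiv_X, pderiv_X]
    simp only [Pi.single_apply]
    split_ifs <;> simp
  have h1 := congrArg (fun D : Derivation R (MvPolynomial σ R) (MvPolynomial σ R) => D f) h
  rw [Derivation.commutator_apply] at h1
  exact sub_eq_zero.1 h1

/-- A sequence of elements of a `ℚ`-algebra is determined by its Witt polynomials. -/
theorem eq_of_aeval_wittPolynomial (p : ℕ) [hp : Fact p.Prime] {Q : Type*} [CommRing Q]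
    [Algebra ℚ Q] {u v : ℕ → Q}
    (h : ∀ n, aeval u (wittPolynomial p ℚ n) = aeval v (wittPolynomial p ℚ n)) : u = v := by
  let : Invertible (p : ℚ) := invertibleOfNonzero (Nat.cast_ne_zero.2 hp.out.ne_zero)
  funext i
  have h1 := congrArg (aeval u) (bind₁_wittPolynomial_xInTermsOfW p ℚ i)
  have h2 := congrArg (aeval v) (bind₁_wittPolynomial_xInTermsOfW p ℚ i)
  rw [aeval_bind₁, aeval_X] at h1 h2
  rw [← h1, ← h2]
  simp only [h]

end MvPolynomial

namespace ArtinHasse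

open MvPolynomial AlgHom TensorProduct

variable (K : Type*) [Field K]

/-- The operator `l ∂/∂v_l + t_l`, where `v_l` and `t_l` are the two families of variables. -/
def lowering (l : ℕ+) : Module.End K (MvPolynomial (ℕ+ ⊕ ℕ+) K) :=
  ((l : ℕ) : K) • (pderiv (Sum.inl l)).toLinearMap + LinearMap.mulLeft K (X (Sum.inr l))

theorem lowering_apply (l : ℕ+) (n : MvPolynomial (ℕ+ ⊕ ℕ+) K) :
    lowering K l n = ((l : ℕ) : K) • pderiv (Sum.inl l) n + X (Sum.inr l) * n := rfl

theorem lowering_comm (k l : ℕ+) : lowering K k * lowering K l = lowering K l * lowering K k := by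
  refine LinearMap.ext fun n => ?_
  rw [Module.End.mul_apply, Module.End.mul_apply]
  simp only [lowering_apply, map_add, map_smul, Derivation.leibniz, smul_eq_mul,
    pderiv_X_of_ne (Sum.inr_ne_inl), mul_zero, add_zero, smul_add]
  rw [smul_comm, pderiv_pderiv_comm, mul_left_comm (X (Sum.inr k))]
  abel

theorem lowering_mulLeft (k l : ℕ+) : lowering K l * LinearMap.mulLeft K (X (Sum.inl k)) =
    LinearMap.mulLeft K (X (Sum.inl k)) * lowering K l +
      if k = l then ((k : ℕ) : Module.End K (MvPolynomial (ℕ+ ⊕ ℕ+) K)) else 0 := by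
  classical
  refine LinearMap.ext fun n => ?_
  rw [Module.End.mul_apply, LinearMap.add_apply, Module.End.mul_apply]
  simp only [lowering_apply, LinearMap.mulLeft_apply, Derivation.leibniz, smul_eq_mul]
  rw [smul_add, mul_add, mul_left_comm (X (Sum.inr l)), mul_smul_comm]
  split_ifs with h
  · subst h
    rw [pderiv_X_self, mul_one, Module.End.natCast_apply, ← Nat.cast_smul_eq_nsmul K]
    abel
  · rw [pderiv_X_of_ne (fun h' => h (Sum.inl_injective h')), mul_zero, smul_zero,
      LinearMap.zero_apply]
    abel

/-- The polynomials not involving the variables `v_l`. -/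
def vacuum : Subalgebra K (MvPolynomial (ℕ+ ⊕ ℕ+) K) where
  carrier := {n | ∀ l : ℕ+, pderiv (Sum.inl l) n = 0}
  mul_mem' ha hb l := by rw [Derivation.leibniz, ha l, hb l, smul_zero, smul_zero, add_zero]
  add_mem' ha hb l := by rw [map_add, ha l, hb l, add_zero]
  algebraMap_mem' r l := by rw [Derivation.map_algebraMap]

variable {K}

theorem apply_eq_aeval_mul {k N ι : Type*} [CommRing k] [CommRing N] [Algebra K N] [Algebra k K]
    [Algebra k N] [IsScalarTower k K N] (χ : MvPolynomial ι k →ₐ[k] Module.End K N) (t : ι → N)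
    (H : Subalgebra K N) (ht : ∀ i, t i ∈ H) (hχ : ∀ i, ∀ n ∈ H, χ (X i) n = t i * n)
    (g : MvPolynomial ι k) : aeval t g ∈ H ∧ ∀ n ∈ H, χ g n = aeval t g * n := by
  induction g using MvPolynomial.induction_on with
  | C r =>
    refine ⟨?_, fun n _ => ?_⟩
    · rw [algHom_C, IsScalarTower.algebraMap_apply k K N]; exact H.algebraMap_mem _
    · rw [algHom_C, algHom_C, Module.algebraMap_end_apply, Algebra.smul_def]
  | add f g hf hg =>
    refine ⟨by rw [map_add]; exact add_mem hf.1 hg.1, fun n hn => ?_⟩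
    rw [map_add, map_add, LinearMap.add_apply, hf.2 n hn, hg.2 n hn, add_mul]
  | mul_X f i hf =>
    refine ⟨by rw [map_mul, aeval_X]; exact mul_mem hf.1 (ht i), fun n hn => ?_⟩
    rw [map_mul, map_mul, aeval_X, Module.End.mul_apply, hχ i n hn, hf.2 _ (mul_mem (ht i) hn),
      mul_assoc]

variable [CharZero K]
variable (p : ℕ) [hp : Fact p.Prime] {c : ℕ+ → ℕ+ → MvPolynomial (ℕ+ ⊕ₗ ℕ+) ℤ} (hc : IsCFamily c)
variable {k : Type*} [CommRing k] [Algebra k K]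

omit hp in
theorem apply_wittPolynomial {S A : Type*} [CommRing S] [Ring A] [Algebra S A] 
    (φ : MvPolynomial ℕ S →ₐ[S] A) (n : ℕ) : φ (wittPolynomial p S n) =
      ∑ i ∈ Finset.range (n + 1), (p : A) ^ i * φ (X i) ^ p ^ (n - i) := by
  rw [wittPolynomial_eq_sum_C_mul_X_pow, map_sum]
  refine Finset.sum_congr rfl fun i _ => ?_
  rw [map_mul, map_pow, map_pow, map_pow, map_natCast, map_natCast]

theorem aeval_ghostInv_ppow {Q : Type*} [CommRing Q] [Algebra ℚ Q]
    {t : ℕ+ → Q} {u : ℕ → Q} 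
    (ht : ∀ n, t (ppow p n) = aeval u (wittPolynomial p ℚ n)) (i : ℕ) :
    aeval t (ghostInv (X : ℕ+ → MvPolynomial ℕ+ ℚ) (ppow p i)) = u i := by
  refine congrFun (eq_of_aeval_wittPolynomial p (u := fun i => aeval t (ghostInv X (ppow p i)))
    (v := u) fun n => ?_) i
  rw [← ht, apply_wittPolynomial]
  simp only [aeval_X]
  have h1 := map_ghost ((aeval t : MvPolynomial ℕ+ ℚ →ₐ[ℚ] Q) : MvPolynomial ℕ+ ℚ →+* Q)
    (ghostInv X) (ppow p n)
  rw [ghost_ghostInv, ghost_ppow] at h1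
  refine h1.symm.trans ?_
  simp

include hc in
theorem exists_model (hinj : Function.Injective (algebraMap k K)) :
    ∃ φ ψ : MvPolynomial ℕ k →ₐ[k] Module.End K (MvPolynomial (ℕ+ ⊕ ℕ+) K),
      Function.Injective (mulTensor φ ψ) ∧ CRel p c φ ψ ∧
      ∀ i j, ψ (wittPolynomial p k j) * φ (wittPolynomial p k i) =
        φ (wittPolynomial p k i) * ψ (wittPolynomial p k j) + if i = j then
          (p : Module.End K (MvPolynomial (ℕ+ ⊕ ℕ+) K)) ^ i else 0 := by
  set N := MvPolynomial (ℕ+ ⊕ ℕ+) K with hN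
  set ξ : ℕ+ → MvPolynomial ℕ+ ℚ := ghostInv X with hξ
  obtain ⟨φ₀, hφ₀⟩ := exists_algHom_of_commute (k := ℚ)
    (A := Module.End K N) (x := fun d : ℕ+ => LinearMap.mulLeft K (X (Sum.inl d) : N)) fun i j => by
      rw [Module.End.mul_eq_comp, Module.End.mul_eq_comp, ← LinearMap.mulLeft_mul,
        ← LinearMap.mulLeft_mul, mul_comm]
  obtain ⟨ψ₀, hψ₀⟩ := exists_algHom_of_commute (k := ℚ) (lowering_comm K)
  have hgx : ∀ d, ghost (fun d => φ₀ (ξ d)) d = φ₀ (X d) := fun d => by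
    rw [← ghost_ghostInv X d]
    exact (map_ghost (φ₀ : MvPolynomial ℕ+ ℚ →+* Module.End K N) ξ d).symm
  have hgy : ∀ d, ghost (fun d => ψ₀ (ξ d)) d = ψ₀ (X d) := fun d => by
    rw [← ghost_ghostInv X d]
    exact (map_ghost (ψ₀ : MvPolynomial ℕ+ ℚ →+* Module.End K N) ξ d).symm
  obtain ⟨φ, hφ⟩ := exists_algHom_of_commute (k := k) (A := Module.End K N)
    (x := fun i => φ₀ (ξ (ppow p i)))
    fun i j => by rw [← map_mul, mul_comm, map_mul]
  obtain ⟨ψ, hψ⟩ := exists_algHom_of_commute (k := k) (A := Module.End K N)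
    (x := fun i => ψ₀ (ξ (ppow p i)))
    fun i j => by rw [← map_mul, mul_comm, map_mul]
  have hφw : ∀ i, φ (wittPolynomial p k i) = φ₀ (X (ppow p i)) := fun i => by
    rw [← hgx, ghost_ppow, apply_wittPolynomial]
    simp only [hφ]
  have hψw : ∀ i, ψ (wittPolynomial p k i) = ψ₀ (X (ppow p i)) := fun i => by
    rw [← hgy, ghost_ppow, apply_wittPolynomial]
    simp only [hψ]
  refine ⟨φ, ψ, ?_, ?_, ?_⟩
  · set τ₁ : MvPolynomial ℕ+ ℚ →ₐ[ℚ] N := aeval fun d => X (Sum.inl d) with hτ₁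
    set τ₂ : MvPolynomial ℕ+ ℚ →ₐ[ℚ] N := aeval fun d => X (Sum.inr d) with hτ₂
    have h1 : ∀ f n, φ f n = aeval (fun i => τ₁ (ξ (ppow p i))) f * n := fun f n => by
      refine (apply_eq_aeval_mul φ _ ⊤ (fun _ => trivial) (fun i n _ => ?_) f).2 n trivial
      rw [hφ]
      refine (apply_eq_aeval_mul φ₀ _ ⊤ (fun _ => trivial) (fun d n _ => ?_) _).2 n trivial
      rw [hφ₀]; rfl
    have h2 : ∀ g n, n ∈ vacuum K → τ₂ g ∈ vacuum K ∧ ψ₀ g n = τ₂ g * n := fun g n hn => by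
      have := apply_eq_aeval_mul ψ₀ (fun d => X (Sum.inr d)) (vacuum K)
        (fun d l => pderiv_X_of_ne Sum.inr_ne_inl) (fun d n hn => by
          rw [hψ₀, lowering_apply, hn d, smul_zero, zero_add]) g
      exact ⟨this.1, this.2 n hn⟩
    have h3 : ∀ g, ψ g 1 = aeval (fun i => τ₂ (ξ (ppow p i))) g := fun g => by
      rw [← mul_one (aeval _ g)]
      refine (apply_eq_aeval_mul ψ _ (vacuum K) (fun i => (h2 _ 1 (one_mem _)).1)
        (fun i n hn => ?_) g).2 1 (one_mem _)
      rw [hψ]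
      exact (h2 _ n hn).2
    set W : ℕ+ → MvPolynomial ℕ K := fun d =>
      if d = ppow p (padicValNat p d) then wittPolynomial p K (padicValNat p d) else 0 with hW
    have hWp : ∀ n, W (ppow p n) = wittPolynomial p K n := fun n => by
      simp only [hW]
      rw [ppow_coe, padicValNat.prime_pow, if_pos rfl]
    set ρ : N →ₐ[K] MvPolynomial (ℕ ⊕ ℕ) K :=
      aeval (Sum.elim (fun d => rename Sum.inl (W d)) fun d => rename Sum.inr (W d)) with hρ
    have hρ₁ : ∀ i, ρ (τ₁ (ξ (ppow p i))) = X (Sum.inl i) := fun i => by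
      have : (ρ.restrictScalars ℚ).comp τ₁ = aeval fun d => rename Sum.inl (W d) := by
        refine algHom_ext fun d => ?_
        rw [AlgHom.comp_apply, hτ₁, aeval_X, aeval_X, AlgHom.restrictScalars_apply, hρ, aeval_X]
        rfl
      refine (congrArg (fun g => g (ξ (ppow p i))) this).trans ?_
      refine aeval_ghostInv_ppow p (u := fun i => X (Sum.inl i)) (fun n => ?_) i
      rw [hWp, apply_wittPolynomial, apply_wittPolynomial]
      simp
    have hρ₂ : ∀ i, ρ (τ₂ (ξ (ppow p i))) = X (Sum.inr i) := fun i => by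
      have : (ρ.restrictScalars ℚ).comp τ₂ = aeval fun d => rename Sum.inr (W d) := by
        refine algHom_ext fun d => ?_
        rw [AlgHom.comp_apply, hτ₂, aeval_X, aeval_X, AlgHom.restrictScalars_apply, hρ, aeval_X]
        rfl
      refine (congrArg (fun g => g (ξ (ppow p i))) this).trans ?_
      refine aeval_ghostInv_ppow p (u := fun i => X (Sum.inr i)) (fun n => ?_) i
      rw [hWp, apply_wittPolynomial, apply_wittPolynomial]
      simp
    have key : ∀ z, ρ (mulTensor φ ψ z 1) =
        MvPolynomial.map (algebraMap k K) (tensorEquivSum k ℕ ℕ k z) := fun z => by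
      induction z using TensorProduct.induction_on with
      | zero => simp
      | add a b ha hb =>
        rw [map_add, LinearMap.add_apply, map_add, ha, hb, map_add, map_add]
      | tmul f g =>
        rw [mulTensor_tmul, Module.End.mul_apply, h3, h1, map_mul]
        have e1 : (ρ.restrictScalars k).comp (aeval fun i => τ₁ (ξ (ppow p i))) =
            ((mapAlgHom (Algebra.ofId k K)).comp
              (tensorEquivSum k ℕ ℕ k).toAlgHom).comp Algebra.TensorProduct.includeLeft := by
          ext i; simp [hρ₁]
        have e2 : (ρ.restrictScalars k).comp (aeval fun i => τ₂ (ξ (ppow p i))) =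
            ((mapAlgHom (Algebra.ofId k K)).comp
              (tensorEquivSum k ℕ ℕ k).toAlgHom).comp Algebra.TensorProduct.includeRight := by
          ext i; simp [hρ₂]
        rw [← mul_one f, ← one_mul g, ← Algebra.TensorProduct.tmul_mul_tmul, mul_one, one_mul,
          map_mul, map_mul]
        exact congrArg₂ (· * ·) (congrArg (fun h => h f) e1) (congrArg (fun h => h g) e2)
    intro z z' hz
    refine (tensorEquivSum k ℕ ℕ k).injective (MvPolynomial.map_injective _ hinj ?_)
    rw [← key, ← key, hz]
  · intro i j
    rw [hφ, hψ]
    refine (hc.cEval_eq (x := fun d => φ₀ (ξ d)) (y := fun d => ψ₀ (ξ d)) ?_ ?_ ?_ _ _).symm.trans ?_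
    · intro d e; rw [hgx, hgx, ← map_mul, mul_comm, map_mul]
    · intro d e; rw [hgy, hgy, ← map_mul, mul_comm, map_mul]
    · intro d e; rw [hgx, hgy, hφ₀, hψ₀]; exact lowering_mulLeft K d e
    · rw [← cEval_ppow (p := p) hc]
      simp only [hφ, hψ]
  · intro i j
    rw [hφw, hψw, hφ₀, hψ₀, lowering_mulLeft]
    congr 1
    have : ppow p i = ppow p j ↔ i = j := by
      rw [← PNat.coe_inj, ppow_coe, ppow_coe, (Nat.pow_right_injective hp.out.two_le).eq_iff]
    simp only [this]
    rw [ppow_coe, Nat.cast_pow]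

end ArtinHasse

namespace ArtinHasse

open MvPolynomial AlgHom

variable {p : ℕ} [hp : Fact p.Prime] {c : ℕ+ → ℕ+ → MvPolynomial (ℕ+ ⊕ₗ ℕ+) ℤ} (hc : IsCFamily c)
  {A : Type*} [Ring A] [Algebra ℤ_[p] A] [CharP A p] {x y : ℕ → A}
  (hx : ∀ i j, x i * x j = x j * x i) (hy : ∀ i j, y i * y j = y j * y i)
  (hyx : ∀ i j, y j * x i - x i * y j = cEval (fun d => x (padicValNat p d))
    (fun e => y (padicValNat p e)) (c (ppow p i) (ppow p j)))
include hc hx hy hyx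

theorem power_commutators :
    (∀ i j k l, y (l + j) ^ p ^ k * x (k + i) ^ p ^ l - x (k + i) ^ p ^ l * y (l + j) ^ p ^ k =
      cEval (fun d => x (k + padicValNat p d) ^ p ^ l) (fun e => y (l + padicValNat p e) ^ p ^ k)
        (c (ppow p i) (ppow p j))) ∧
    (∀ i j k, i < k → Commute (y j ^ p ^ k) (x i)) ∧
    (∀ i j l, j < l → Commute (y j) (x i ^ p ^ l)) ∧
    ∀ i j, y j ^ p ^ i * x i ^ p ^ j - x i ^ p ^ j * y j ^ p ^ i = 1 := by
  obtain ⟨E, hE, hE'⟩ := exists_artinHasse p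
  obtain ⟨φ, hφ⟩ := exists_algHom_of_commute (k := ℤ_[p]) hx
  obtain ⟨ψ, hψ⟩ := exists_algHom_of_commute (k := ℤ_[p]) hy
  obtain ⟨φ', ψ', hinj, hrel, hghost⟩ := exists_model (K := ℚ_[p]) p hc (k := ℤ_[p])
    (IsFractionRing.injective ℤ_[p] ℚ_[p])
  have : IsAddTorsionFree (Module.End ℚ_[p] (MvPolynomial (ℕ+ ⊕ ℕ+) ℚ_[p])) :=
    IsAddTorsionFree.of_module_rat _
  have hstar' := star_of_ghost p E hE hE' φ' ψ' hghost
  have hstar : Star p E φ ψ := CRel.star hc hinj (fun i j => by simpa only [hφ, hψ] using hyx i j)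
    hrel hstar'
  refine ⟨fun i j k l => ?_, fun i j k hik => ?_, fun i j l hjl => ?_, fun i j => ?_⟩
  · obtain ⟨φ₁, ψ₁, h, h1, h2⟩ := Star.iterate p hE hE' hstar k l
    have := Star.cRel hE hE' hinj h hstar' hrel i j
    simpa only [h1, h2, hφ, hψ] using this
  · obtain ⟨φ₁, ψ₁, h, h1, h2⟩ := Star.iterate p hE hE' hstar i 0
    have := (Star.commute p hE hE' h (X j)).symm
    rw [expand_X, map_pow, h1, h2, hφ, hψ, pow_zero, pow_one, zero_add, add_zero, ← pow_mul,
      ← pow_succ] at this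
    obtain ⟨m, rfl⟩ := Nat.exists_eq_add_of_lt hik
    rw [show i + m + 1 = (i + 1) + m by ring, pow_add p, pow_mul]
    exact this.pow_left _
  · obtain ⟨φ₁, ψ₁, h, h1, h2⟩ := Star.iterate p hE hE' hstar 0 j
    have := Star.commute' p hE hE' h (X i)
    rw [expand_X, map_pow, h1, h2, hφ, hψ, pow_zero, pow_one, zero_add, add_zero, ← pow_mul,
      ← pow_succ] at this
    obtain ⟨m, rfl⟩ := Nat.exists_eq_add_of_lt hjl
    rw [show j + m + 1 = (j + 1) + m by ring, pow_add p, pow_mul]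
    exact this.pow_right _
  · obtain ⟨φ₁, ψ₁, h, h1, h2⟩ := Star.iterate p hE hE' hstar i j
    have h11 := h 1 1
    have h0 : theta p E 0 = 1 := by simp [theta]
    rw [theta_one p E hE hE', h1, h2, hφ, hψ, min_self, Finset.sum_range_succ,
      Finset.sum_range_one, Nat.sub_zero, Nat.sub_self, theta_one p E hE hE', h0,
      coeff_one_eq p E hE hE', h1, h2, hφ, hψ, PowerSeries.coeff_zero_eq_constantCoeff_apply, hE]
      at h11
    simpa [sub_eq_iff_eq_add'] using h11

end ArtinHasse

/-- Fix a prime `p` and a commutative ring `R` of characteristic `p`.  In the `p`-typical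
algebra `B(R)`, for all `i, j, k, l ∈ ℕ`: if `i ≥ k` and `j ≥ l` then
`[y_j^{p^k}, x_i^{p^l}] = c_{i−k, j−l}(x_k^{p^l}, …, x_{i−1}^{p^l}, y_l^{p^k}, …, y_{j−1}^{p^k})`
(the polynomial `c_{i−k,j−l}` evaluated with `X_r ↦ x_{k+r}^{p^l}` and `Y_s ↦ y_{l+s}^{p^k}`);
otherwise `[y_j^{p^k}, x_i^{p^l}] = 0`.  In particular `[y_j^{p^i}, x_i^{p^j}] = 1`, and
`[y_j^{p^k}, x_i] = 0` for `k > i`, `[y_j, x_i^{p^l}] = 0` for `l > j`. -/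
theorem bI_power_commutators (p : ℕ) (hp : p.Prime) (R : Type*) [CommRing R] [CharP R p]
    (c : ℕ+ → ℕ+ → MvPolynomial (ℕ+ ⊕ₗ ℕ+) ℤ) (hc : IsCFamily c) :
    (∀ i j k l : ℕ, k ≤ i → l ≤ j →
      gyI R p c j ^ p ^ k * gxI R p c i ^ p ^ l - gxI R p c i ^ p ^ l * gyI R p c j ^ p ^ k =
        cEval (fun d => gxI R p c (k + padicValNat p (d : ℕ)) ^ p ^ l)
              (fun e => gyI R p c (l + padicValNat p (e : ℕ)) ^ p ^ k)
              (c (ppow p (i - k)) (ppow p (j - l)))) ∧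
    (∀ i j k l : ℕ, ¬(k ≤ i ∧ l ≤ j) →
      gyI R p c j ^ p ^ k * gxI R p c i ^ p ^ l - gxI R p c i ^ p ^ l * gyI R p c j ^ p ^ k
        = 0) ∧
    (∀ i j : ℕ,
      gyI R p c j ^ p ^ i * gxI R p c i ^ p ^ j - gxI R p c i ^ p ^ j * gyI R p c j ^ p ^ i
        = 1) ∧
    (∀ i j k : ℕ, i < k →
      gyI R p c j ^ p ^ k * gxI R p c i - gxI R p c i * gyI R p c j ^ p ^ k = 0) ∧
    (∀ i j l : ℕ, j < l →
      gyI R p c j * gxI R p c i ^ p ^ l - gxI R p c i ^ p ^ l * gyI R p c j = 0) := by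
  rcases subsingleton_or_nontrivial (BI R p c) with hA | hA
  · exact ⟨fun _ _ _ _ _ _ => Subsingleton.elim _ _, fun _ _ _ _ _ => Subsingleton.elim _ _,
      fun _ _ => Subsingleton.elim _ _, fun _ _ _ _ => Subsingleton.elim _ _,
      fun _ _ _ _ => Subsingleton.elim _ _⟩
  have : Fact p.Prime := ⟨hp⟩
  have hpA : (p : BI R p c) = 0 := by
    rw [← map_natCast (algebraMap R (BI R p c)), CharP.cast_eq_zero, map_zero]
  have : CharP (BI R p c) p := (CharP.charP_iff_prime_eq_zero hp).2 hpA
  let _ : Algebra ℤ_[p] (BI R p c) :=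
    ((algebraMap R (BI R p c)).comp
      ((ZMod.castHom (dvd_refl p) R).comp PadicInt.toZMod)).toAlgebra'
      fun r a => Algebra.commutes (R := R)
        (((ZMod.castHom (dvd_refl p) R).comp PadicInt.toZMod) r) a
  have hrel : ∀ {a b}, BIRel R p c a b →
      RingQuot.mkAlgHom R (BIRel R p c) a = RingQuot.mkAlgHom R (BIRel R p c) b := fun h =>
    RingQuot.mkAlgHom_rel R h
  have hx : ∀ i j, gxI R p c i * gxI R p c j = gxI R p c j * gxI R p c i := fun i j => by
    simpa only [map_mul, gxI] using hrel (.xx i j)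
  have hy : ∀ i j, gyI R p c i * gyI R p c j = gyI R p c j * gyI R p c i := fun i j => by
    simpa only [map_mul, gyI] using hrel (.yy i j)
  have hyx : ∀ i j, gyI R p c j * gxI R p c i - gxI R p c i * gyI R p c j =
      cEval (fun d => gxI R p c (padicValNat p d)) (fun e => gyI R p c (padicValNat p e))
        (c (ppow p i) (ppow p j)) := fun i j => by
    have h1 := hrel (.yx i j)
    rw [map_add, map_mul, map_mul] at h1
    rw [sub_eq_iff_eq_add']
    refine h1.trans (congrArg (fun t => gxI R p c i * gyI R p c j + t) ?_)
    exact map_cEval (RingQuot.mkAlgHom R (BIRel R p c) : FreeAlgebra R (ℕ ⊕ ℕ) →+* BI R p c) _ _ _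
  obtain ⟨h1, h2, h3, h4⟩ := ArtinHasse.power_commutators hc hx hy hyx
  refine ⟨fun i j k l hk hl => ?_, fun i j k l h => ?_, h4, fun i j k h => ?_, fun i j l h => ?_⟩
  · have := h1 (i - k) (j - l) k l
    rwa [Nat.add_sub_cancel' hk, Nat.add_sub_cancel' hl] at this
  · rw [sub_eq_zero]
    rcases not_and_or.1 h with h | h
    · exact ((h2 i j k (not_le.1 h)).pow_right _).eq
    · exact ((h3 i j l (not_le.1 h)).pow_left _).eq
  · exact sub_eq_zero.2 (h2 i j k h).eq
  · exact sub_eq_zero.2 (h3 i j l h).eq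

end
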